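/- arXiv:2605.21388 — 4 statements merged into one kernel-verified Lean document; each statement's English description precedes it below -/
import Mathlib

section
/- Let Y ⊂ ℝ^d be a bounded convex open set and define d(z) := dist(z, ℝ^d \ Y). Let A be a symmetric positive definite d×d matrix and x₀ ∈ Y a point such that the ellipsoid E = {x₀ + A v : ‖v‖ ≤ 1} is contained in Y. Then ∫_E d(x) dx ≤ 2^{d+1} ∫_{E₁/₂} d(y) dy, where E₁/₂ = {x₀ + (1/2) A v : ‖v‖ ≤ 1} is the half-dilation of E about its center. -/
open MeasureTheory Metric

/-- Let `Y ⊂ ℝ^d` be a bounded convex open set and let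
`dY(z) = dist(z, ℝ^d \ Y)` be the distance-to-complement function. For any ellipsoid
`E = x₀ + A (closedBall 0 1)` (with `A` symmetric positive definite, `x₀ ∈ Y`)
contained in `Y`, one has `∫_E dY ≤ 2^{d+1} ∫_{E½} dY`, where `E½` is the
half-dilation of `E` about its center. -/
theorem stmt_2 (d : ℕ) (Y : Set (EuclideanSpace ℝ (Fin d)))
    (hYbdd : Bornology.IsBounded Y) (hYconv : Convex ℝ Y) (hYopen : IsOpen Y)
    (A : Matrix (Fin d) (Fin d) ℝ) (hA : A.PosDef)
    (x₀ : EuclideanSpace ℝ (Fin d)) (hx₀ : x₀ ∈ Y)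
    (hE : (fun v : EuclideanSpace ℝ (Fin d) => x₀ + Matrix.toEuclideanLin A v) ''
        closedBall 0 1 ⊆ Y) :
    ∫ x in (fun v : EuclideanSpace ℝ (Fin d) =>
        x₀ + Matrix.toEuclideanLin A v) '' closedBall 0 1, Metric.infDist x Yᶜ ≤
      2 ^ (d + 1) *
        ∫ y in (fun v : EuclideanSpace ℝ (Fin d) =>
          x₀ + ((1 : ℝ) / 2) • Matrix.toEuclideanLin A v) '' closedBall 0 1,
            Metric.infDist y Yᶜ := by
  set E : Set (EuclideanSpace ℝ (Fin d)) := (fun v : (EuclideanSpace ℝ (Fin d)) => x₀ + Matrix.toEuclideanLin A v) '' closedBall 0 1 with hEdef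
  have hEc : IsCompact E := by
    refine (isCompact_closedBall (0 : (EuclideanSpace ℝ (Fin d))) 1).image ?_
    exact continuous_const.add (LinearMap.continuous_of_finiteDimensional _)
  let h : (EuclideanSpace ℝ (Fin d)) → (EuclideanSpace ℝ (Fin d)) := fun x => x₀ + ((1 : ℝ) / 2) • (x - x₀)
  have hhalf : (fun v : (EuclideanSpace ℝ (Fin d)) => x₀ + ((1 : ℝ) / 2) • Matrix.toEuclideanLin A v) '' closedBall 0 1
      = h '' E := by
    rw [hEdef, Set.image_image]
    refine Set.image_congr fun v _ => ?_
    simp [h]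
  have hhc : Continuous h := by fun_prop
  have hder : ∀ x ∈ E, HasFDerivWithinAt h (((1 : ℝ) / 2) • ContinuousLinearMap.id ℝ (EuclideanSpace ℝ (Fin d))) E x := by
    intro x _
    exact ((((hasFDerivAt_id x).sub_const x₀).const_smul ((1 : ℝ) / 2)).const_add
      x₀).hasFDerivWithinAt
  have hinj : Set.InjOn h E := by
    intro x _ y _ hxy
    simpa [h] using hxy
  have key : ∀ x ∈ E, Metric.infDist x Yᶜ ≤ 2 * Metric.infDist (h x) Yᶜ := by
    intro x _
    rcases Set.eq_empty_or_nonempty Yᶜ with he | hne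
    · simp [he]
    · have : Metric.infDist x Yᶜ / 2 ≤ Metric.infDist (h x) Yᶜ := by
        rw [Metric.le_infDist hne]
        intro w hw
        by_contra! hlt
        apply hw
        have hd : dist x (x₀ + (2 : ℝ) • (w - x₀)) = 2 * dist (h x) w := by
          have : x - (x₀ + (2 : ℝ) • (w - x₀)) = (2 : ℝ) • (h x - w) := by
            simp only [h]; module
          rw [dist_eq_norm, dist_eq_norm, this, norm_smul]; norm_num
        have hx' : x₀ + (2 : ℝ) • (w - x₀) ∈ Y := by
          by_contra hn
          have := Metric.infDist_le_dist_of_mem (x := x) (s := Yᶜ) hn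
          linarith
        have := hYconv hx₀ hx' (a := 1 / 2) (b := 1 / 2) (by norm_num) (by norm_num) (by norm_num)
        convert this using 1
        module
      linarith
  rw [hhalf, integral_image_eq_integral_abs_det_fderiv_smul volume hEc.measurableSet hder hinj]
  have hdet : |(((1 : ℝ) / 2) • ContinuousLinearMap.id ℝ (EuclideanSpace ℝ (Fin d))).det| = (1 / 2) ^ d := by
    have : (((1 : ℝ) / 2) • ContinuousLinearMap.id ℝ (EuclideanSpace ℝ (Fin d))).det = (1 / 2) ^ d := by
      rw [ContinuousLinearMap.det, ContinuousLinearMap.toLinearMap_smul, LinearMap.det_smul]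
      simp
    rw [this, abs_of_nonneg (by positivity)]
  simp only [hdet, smul_eq_mul]
  rw [integral_const_mul, ← mul_assoc]
  have hc : (2 : ℝ) ^ (d + 1) * (1 / 2) ^ d = 2 := by
    rw [pow_succ, mul_right_comm, ← mul_pow]; norm_num
  rw [hc, ← integral_const_mul]
  refine setIntegral_mono_on ?_ ?_ hEc.measurableSet key
  · exact (Metric.continuous_infDist_pt _).continuousOn.integrableOn_compact hEc
  · exact (((Metric.continuous_infDist_pt _).comp hhc).const_mul
      2).continuousOn.integrableOn_compact hEc
end

section
/- Let Y ⊂ ℝ^d be a bounded convex open set, let d(z) := dist(z, ℝ^d \ Y), and let u : Y → ℝ be a measurable function satisfying C₁ d(x) ≤ u(x) ≤ C₂ d(x) for all x ∈ Y, where 0 < C₁ ≤ C₂ < ∞. Then for every symmetric positive definite d×d matrix A and every x₀ ∈ Y such that the ellipsoid E = {x₀ + A v : ‖v‖ ≤ 1} is contained in Y, one has ∫_E u(x) dx ≤ 2^{d+1} (C₂/C₁) ∫_{E₁/₂} u(y) dy, where E₁/₂ = {x₀ + (1/2) A v : ‖v‖ ≤ 1}. In particular, the measure u(x) dx is doubling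 on Y with doubling constant 2^{d+1} C₂/C₁. -/
open MeasureTheory Metric
open scoped Pointwise

lemma infDist_half_aux {d : ℕ} (Y : Set (EuclideanSpace ℝ (Fin d))) (hYconv : Convex ℝ Y)
    (x₀ : EuclideanSpace ℝ (Fin d)) (hx₀ : x₀ ∈ Y) (v : EuclideanSpace ℝ (Fin d)) :
    infDist (x₀ + v) Yᶜ ≤ 2 * infDist (x₀ + (1 / 2 : ℝ) • v) Yᶜ := by
  rcases Set.eq_empty_or_nonempty Yᶜ with h | h
  · simp [h]
  have key : infDist (x₀ + v) Yᶜ / 2 ≤ infDist (x₀ + (1 / 2 : ℝ) • v) Yᶜ := by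
    rw [le_infDist h]
    intro z hz
    by_contra hlt
    push Not at hlt
    have hw : (2 : ℝ) • z - x₀ ∈ Y := by
      by_contra hw
      have h1 : infDist (x₀ + v) Yᶜ ≤ dist (x₀ + v) ((2 : ℝ) • z - x₀) :=
        infDist_le_dist_of_mem hw
      have h2 : x₀ + v - ((2 : ℝ) • z - x₀) = (2 : ℝ) • (x₀ + (1 / 2 : ℝ) • v - z) := by
        module
      rw [dist_eq_norm, h2, norm_smul, ← dist_eq_norm] at h1
      norm_num at h1 hlt
      linarith
    apply hz
    have := hYconv hw hx₀ (by norm_num : (0 : ℝ) ≤ 1 / 2) (by norm_num : (0 : ℝ) ≤ 1 / 2)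
      (by norm_num)
    convert this using 1
    module
  linarith

lemma setIntegral_translate_aux {d : ℕ} (x₀ : EuclideanSpace ℝ (Fin d))
    (S : Set (EuclideanSpace ℝ (Fin d))) (g : EuclideanSpace ℝ (Fin d) → ℝ) :
    ∫ x in (fun v => x₀ + v) '' S, g x = ∫ v in S, g (x₀ + v) :=
  (measurePreserving_add_left volume x₀).setIntegral_image_emb
    (measurableEmbedding_addLeft x₀) g S

set_option maxHeartbeats 2000000 in
/-- Let `Y ⊂ ℝ^d` be a bounded convex open set, `dY(z) = dist(z, ℝ^d \ Y)`,
and let `u` be measurable with `C₁ dY(x) ≤ u(x) ≤ C₂ dY(x)` on `Y`, `0 < C₁ ≤ C₂`.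
Then for any ellipsoid `E = x₀ + A (closedBall 0 1)` (with `A` symmetric positive
definite, `x₀ ∈ Y`) contained in `Y`, one has
`∫_E u ≤ 2^{d+1} (C₂/C₁) ∫_{E½} u`, i.e. `u dx` is doubling with constant
`2^{d+1} C₂/C₁`. -/
theorem stmt_3 (d : ℕ) (Y : Set (EuclideanSpace ℝ (Fin d)))
    (hYbdd : Bornology.IsBounded Y) (hYconv : Convex ℝ Y) (hYopen : IsOpen Y)
    (u : EuclideanSpace ℝ (Fin d) → ℝ) (hu : Measurable u)
    (C₁ C₂ : ℝ) (hC₁ : 0 < C₁) (hC₁₂ : C₁ ≤ C₂)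
    (hlb : ∀ x ∈ Y, C₁ * Metric.infDist x Yᶜ ≤ u x)
    (hub : ∀ x ∈ Y, u x ≤ C₂ * Metric.infDist x Yᶜ)
    (A : Matrix (Fin d) (Fin d) ℝ) (hA : A.PosDef)
    (x₀ : EuclideanSpace ℝ (Fin d)) (hx₀ : x₀ ∈ Y)
    (hE : (fun v : EuclideanSpace ℝ (Fin d) => x₀ + Matrix.toEuclideanLin A v) ''
        closedBall 0 1 ⊆ Y) :
    ∫ x in (fun v : EuclideanSpace ℝ (Fin d) =>
        x₀ + Matrix.toEuclideanLin A v) '' closedBall 0 1, u x ≤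
      2 ^ (d + 1) * (C₂ / C₁) *
        ∫ y in (fun v : EuclideanSpace ℝ (Fin d) =>
          x₀ + ((1 : ℝ) / 2) • Matrix.toEuclideanLin A v) '' closedBall 0 1, u y := by
  set L := Matrix.toEuclideanLin A with hL
  set S : Set (EuclideanSpace ℝ (Fin d)) := L '' closedBall 0 1 with hS
  set D : EuclideanSpace ℝ (Fin d) → ℝ := fun x => infDist x Yᶜ with hD
  have hDc : Continuous D := continuous_infDist_pt _
  have hLc : Continuous L := L.continuous_of_finiteDimensional
  have hScomp : IsCompact S := (isCompact_closedBall 0 1).image hLc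
  have hE1 : (fun v : EuclideanSpace ℝ (Fin d) => x₀ + L v) '' closedBall 0 1
      = (fun v => x₀ + v) '' S := by
    rw [hS, Set.image_image]
  have hE2 : (fun v : EuclideanSpace ℝ (Fin d) => x₀ + ((1 : ℝ) / 2) • L v) '' closedBall 0 1
      = (fun v => x₀ + v) '' ((1 / 2 : ℝ) • S) := by
    rw [hS, ← Set.image_smul, Set.image_image, Set.image_image]
  rw [hE1] at hE
  rw [hE1, hE2]
  set E := (fun v => x₀ + v) '' S with hEdef
  set F := (fun v => x₀ + v) '' ((1 / 2 : ℝ) • S) with hFdef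
  have hEc : IsCompact E := hScomp.image (by fun_prop)
  have hFc : IsCompact F := (hScomp.smul (1 / 2 : ℝ)).image (by fun_prop)
  have hF : F ⊆ Y := by
    rintro _ ⟨_, ⟨s, hs, rfl⟩, rfl⟩
    have h1 : x₀ + s ∈ Y := hE ⟨s, hs, rfl⟩
    have := hYconv h1 hx₀ (by norm_num : (0 : ℝ) ≤ 1 / 2) (by norm_num : (0 : ℝ) ≤ 1 / 2)
      (by norm_num)
    convert this using 1
    simp only []
    module
  have hC₂ : 0 < C₂ := hC₁.trans_le hC₁₂
  have hui : ∀ K : Set (EuclideanSpace ℝ (Fin d)), IsCompact K → K ⊆ Y →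
      IntegrableOn u K := by
    intro K hK hKY
    refine Integrable.mono' (g := fun x => C₂ * D x)
      ((hDc.const_mul C₂).continuousOn.integrableOn_compact hK)
      hu.aestronglyMeasurable ?_
    refine (ae_restrict_iff' hK.measurableSet).2 (Filter.Eventually.of_forall fun x hx => ?_)
    have h0 : 0 ≤ C₁ * infDist x Yᶜ := mul_nonneg hC₁.le infDist_nonneg
    rw [Real.norm_of_nonneg (h0.trans (hlb x (hKY hx)))]
    exact hub x (hKY hx)
  have hDE : IntegrableOn D E := hDc.continuousOn.integrableOn_compact hEc
  have hDF : IntegrableOn D F := hDc.continuousOn.integrableOn_compact hFc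
  have s1 : ∫ x in E, u x ≤ C₂ * ∫ x in E, D x := by
    rw [← integral_const_mul]
    exact setIntegral_mono_on (hui E hEc hE) (hDE.const_mul C₂) hEc.measurableSet
      fun x hx => hub x (hE hx)
  have s2 : C₁ * ∫ x in F, D x ≤ ∫ x in F, u x := by
    rw [← integral_const_mul]
    exact setIntegral_mono_on (hDF.const_mul C₁) (hui F hFc hF) hFc.measurableSet
      fun x hx => hlb x (hF hx)
  have s3 : ∫ x in E, D x ≤ 2 ^ (d + 1) * ∫ x in F, D x := by
    rw [hEdef, hFdef, setIntegral_translate_aux, setIntegral_translate_aux]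
    have hcv := Measure.setIntegral_comp_smul (volume : Measure (EuclideanSpace ℝ (Fin d)))
      (fun v => D (x₀ + v)) S (by norm_num : (1 / 2 : ℝ) ≠ 0)
    have hcv' : ∫ v in S, D (x₀ + (1 / 2 : ℝ) • v)
        = 2 ^ d * ∫ v in (1 / 2 : ℝ) • S, D (x₀ + v) := by
      have hc : |((1 / 2 : ℝ) ^ d)⁻¹| = 2 ^ d := by
        rw [abs_of_pos (by positivity), ← inv_pow]
        norm_num
      rw [hcv, finrank_euclideanSpace_fin, hc, smul_eq_mul]
    have hm : ∫ v in S, D (x₀ + v) ≤ ∫ v in S, 2 * D (x₀ + (1 / 2 : ℝ) • v) := by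
      refine setIntegral_mono_on ?_ ?_ hScomp.measurableSet
        fun v _ => infDist_half_aux Y hYconv x₀ hx₀ v
      · exact (hDc.comp (by fun_prop)).continuousOn.integrableOn_compact hScomp
      · exact (continuous_const.mul (hDc.comp (by fun_prop))).continuousOn.integrableOn_compact
          hScomp
    rw [integral_const_mul, hcv'] at hm
    calc _ ≤ _ := hm
      _ = _ := by ring
  calc ∫ x in E, u x ≤ C₂ * (2 ^ (d + 1) * ∫ x in F, D x) :=
        s1.trans (mul_le_mul_of_nonneg_left s3 hC₂.le)
    _ = 2 ^ (d + 1) * (C₂ / C₁) * (C₁ * ∫ x in F, D x) := by field_simp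
    _ ≤ _ := mul_le_mul_of_nonneg_left s2 (by positivity)
end

section
/- Let B ⊂ ℝ^d be the open Euclidean unit ball and w(x) = 1 − ‖x‖². Then for every symmetric positive definite d×d matrix A and every x₀ ∈ B such that the ellipsoid E = {x₀ + A v : ‖v‖ ≤ 1} is contained in B, one has ∫_E w(x) dx ≤ 2^{d+2} ∫_{E₁/₂} w(y) dy, where E₁/₂ = {x₀ + (1/2) A v : ‖v‖ ≤ 1}. (This follows from the two-sided comparison 1 − ‖x‖ ≤ w(x) ≤ 2(1 − ‖x‖) on B, where 1 − ‖x‖ = dist(x, ℝ^d \ B).) -/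
open MeasureTheory Metric

/-- Let `B ⊂ ℝ^d` be the open unit ball and `w(x) = 1 − ‖x‖²`.
For any ellipsoid `E = x₀ + A (closedBall 0 1)` (with `A` symmetric positive
definite, `x₀ ∈ B`) contained in `B`, one has `∫_E w ≤ 2^{d+2} ∫_{E½} w`,
where `E½` is the half-dilation of `E` about its center. -/
theorem stmt_10 (d : ℕ)
    (A : Matrix (Fin d) (Fin d) ℝ) (hA : A.PosDef)
    (x₀ : EuclideanSpace ℝ (Fin d)) (hx₀ : x₀ ∈ ball (0 : EuclideanSpace ℝ (Fin d)) 1)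
    (hE : (fun v : EuclideanSpace ℝ (Fin d) => x₀ + Matrix.toEuclideanLin A v) ''
        closedBall 0 1 ⊆ ball (0 : EuclideanSpace ℝ (Fin d)) 1) :
    ∫ x in (fun v : EuclideanSpace ℝ (Fin d) =>
        x₀ + Matrix.toEuclideanLin A v) '' closedBall 0 1, (1 - ‖x‖ ^ 2) ≤
      2 ^ (d + 2) *
        ∫ y in (fun v : EuclideanSpace ℝ (Fin d) =>
          x₀ + ((1 : ℝ) / 2) • Matrix.toEuclideanLin A v) '' closedBall 0 1,
            (1 - ‖y‖ ^ 2) := by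
  classical
  set E : Set (EuclideanSpace ℝ (Fin d)) := (fun v : EuclideanSpace ℝ (Fin d) =>
        x₀ + Matrix.toEuclideanLin A v) '' closedBall 0 1 with hEdef
  let h : EuclideanSpace ℝ (Fin d) → EuclideanSpace ℝ (Fin d) :=
    fun x => x₀ + ((1 : ℝ) / 2) • (x - x₀)
  have himg : (fun v : EuclideanSpace ℝ (Fin d) =>
          x₀ + ((1 : ℝ) / 2) • Matrix.toEuclideanLin A v) '' closedBall 0 1 = h '' E := by
    rw [hEdef, Set.image_image]
    simp [h]
  have hcont : Continuous (fun v : EuclideanSpace ℝ (Fin d) =>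
      x₀ + Matrix.toEuclideanLin A v) :=
    continuous_const.add (LinearMap.continuous_of_finiteDimensional _)
  have hEc : IsCompact E := (isCompact_closedBall _ _).image hcont
  have hEm : MeasurableSet E := hEc.isClosed.measurableSet
  have hh : Continuous h := by fun_prop
  have hder : ∀ x ∈ E, HasFDerivWithinAt h
      (((1 : ℝ) / 2) • ContinuousLinearMap.id ℝ (EuclideanSpace ℝ (Fin d))) E x := by
    intro x _
    exact ((((hasFDerivAt_id x).sub_const x₀).const_smul ((1 : ℝ) / 2)).const_add
      x₀).hasFDerivWithinAt
  have hinj : Set.InjOn h E := by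
    intro x _ y _ hxy
    have h1 : ((1 : ℝ) / 2) • (x - x₀) = ((1 : ℝ) / 2) • (y - x₀) := add_left_cancel hxy
    have h2 := smul_right_injective _ (by norm_num : ((1 : ℝ) / 2) ≠ 0) h1
    exact sub_left_injective h2
  rw [himg, integral_image_eq_integral_abs_det_fderiv_smul volume hEm hder hinj]
  have hdet : |(((1 : ℝ) / 2) • ContinuousLinearMap.id ℝ (EuclideanSpace ℝ (Fin d))).det|
      = (1 / 2) ^ d := by
    have : (((1 : ℝ) / 2) • ContinuousLinearMap.id ℝ (EuclideanSpace ℝ (Fin d))).det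
      = (1 / 2) ^ d := by
      simp [ContinuousLinearMap.det]
    rw [this, abs_of_nonneg (by positivity)]
  simp only [hdet, smul_eq_mul]
  rw [integral_const_mul, ← mul_assoc]
  have hc : (2 : ℝ) ^ (d + 2) * (1 / 2) ^ d = 4 := by
    rw [pow_add, mul_right_comm, ← mul_pow]; norm_num
  rw [hc, ← integral_const_mul]
  have hx₀' : ‖x₀‖ < 1 := by simpa using hx₀
  refine setIntegral_mono_on ?_ ?_ hEm ?_
  · exact (Continuous.continuousOn (by fun_prop)).integrableOn_compact hEc
  · exact (Continuous.continuousOn (by fun_prop)).integrableOn_compact hEc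
  · intro x hx
    have hx1 : ‖x‖ < 1 := by simpa using hE hx
    have hhx : h x = ((1 : ℝ) / 2) • (x₀ + x) := by
      simp only [h]; module
    have hn : ‖h x‖ ≤ (‖x₀‖ + ‖x‖) / 2 := by
      rw [hhx, norm_smul]
      have := norm_add_le x₀ x
      norm_num
      linarith
    have h0 := norm_nonneg (h x)
    have h1 := norm_nonneg x
    have h2 := norm_nonneg x₀
    have hsq : ‖h x‖ ^ 2 ≤ ((‖x₀‖ + ‖x‖) / 2) ^ 2 := by gcongr
    nlinarith [sq_nonneg (‖x₀‖ - ‖x‖)]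
end

section
/- Let d ∈ ℕ, B > 0, α ∈ (0,1], λ > 0, and let E ⊆ [−B, B]^d. Let f : E → ℝ be α-Hölder continuous with constant λ, i.e. |f(x) − f(y)| ≤ λ‖x − y‖^α for all x, y ∈ E. Then for arbitrary W, L ∈ ℕ⁺ there exists a feedforward ReLU neural network φ : ℝ^d → ℝ of width at most 3^{d+3} max{d⌊W^{1/d}⌋, W + 1} and depth at most 12L + 14 + 2d such that sup_{x ∈ E} |f(x) − φ(x)| ≤ 19√d · λ (2B)^α W^{−2α/d} L^{−2α/d}. -/
open scoped BigOperators

/-- Forward pass of a feedforward ReLU network: `reluForward dims A b n` applies `n`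
relu-layers `x ↦ σ(A_k x + b_k)` (σ the componentwise ReLU) in order. -/
noncomputable def reluForward (dims : ℕ → ℕ)
    (A : ∀ n : ℕ, Matrix (Fin (dims (n + 1))) (Fin (dims n)) ℝ)
    (b : ∀ n : ℕ, Fin (dims (n + 1)) → ℝ) :
    ∀ n : ℕ, (Fin (dims 0) → ℝ) → Fin (dims n) → ℝ
  | 0 => fun x => x
  | n + 1 => fun x i => max (((A n).mulVec (reluForward dims A b n x)) i + b n i) 0

/-- `IsReLUNet d w l φ` : `φ : ℝ^d → ℝ` is a feedforward ReLU neural network of width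
at most `w` and depth `l`, i.e. `φ = A_{l+1} ∘ σ ∘ A_l ∘ σ ∘ ⋯ ∘ σ ∘ A₁` with affine
layers `A_k` between spaces of dimensions at most `w` (input dimension `d`, output
dimension `1`), `σ` the componentwise ReLU. -/
def IsReLUNet (d w l : ℕ) (φ : EuclideanSpace ℝ (Fin d) → ℝ) : Prop :=
  ∃ (dims : ℕ → ℕ) (h0 : dims 0 = d),
    (∀ n : ℕ, 1 ≤ n → n ≤ l → dims n ≤ w) ∧
    ∃ (A : ∀ n : ℕ, Matrix (Fin (dims (n + 1))) (Fin (dims n)) ℝ)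
      (b : ∀ n : ℕ, Fin (dims (n + 1)) → ℝ)
      (c : Fin (dims l) → ℝ) (c₀ : ℝ),
      ∀ x : EuclideanSpace ℝ (Fin d),
        φ x = (∑ i, c i * reluForward dims A b l (fun j => x (Fin.cast h0 j)) i) + c₀


namespace RN
open Classical Finset

/-- Affine combinations of a set of functions. -/
def Aff {X : Type*} (S : Set (X → ℝ)) : Submodule ℝ (X → ℝ) :=
  Submodule.span ℝ (insert (1 : X → ℝ) S)

/-- Componentwise ReLU of a function. -/
noncomputable def relu {X : Type*} (f : X → ℝ) : X → ℝ := fun x => max (f x) 0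

/-- One hidden layer with at most `w` neurons. -/
def Step {X : Type*} (w : ℕ) (S T : Set (X → ℝ)) : Prop :=
  ∃ G : Finset (X → ℝ), G.card ≤ w ∧ (∀ g ∈ G, g ∈ Aff S) ∧
    T ⊆ Aff (relu '' (G : Set (X → ℝ)))

/-- `l` hidden layers with at most `w` neurons each. -/
def Steps {X : Type*} (w : ℕ) : ℕ → Set (X → ℝ) → Set (X → ℝ) → Prop
  | 0, S, T => T ⊆ Aff S
  | l + 1, S, T => ∃ R, Step w S R ∧ Steps w l R T

section basic
variable {X : Type*} {S T R T₁ T₂ : Set (X → ℝ)} {f g : X → ℝ} {w w₁ w₂ l l₁ l₂ : ℕ}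

theorem Aff.self (h : f ∈ S) : f ∈ Aff S := Submodule.subset_span (Set.mem_insert_of_mem _ h)

theorem Aff.sub_set : S ⊆ Aff S := fun _ h => Aff.self h

theorem Aff.one : (1 : X → ℝ) ∈ Aff S := Submodule.subset_span (Set.mem_insert _ _)

theorem Aff.congr (h : g ∈ Aff S) (e : ∀ x, f x = g x) : f ∈ Aff S := by
  have : f = g := funext e
  rwa [this]

theorem Aff.const (c : ℝ) : (fun _ : X => c) ∈ Aff S :=
  Aff.congr ((Aff S).smul_mem c Aff.one) (by intro x; simp)

theorem Aff.add (hf : f ∈ Aff S) (hg : g ∈ Aff S) : (fun x => f x + g x) ∈ Aff S :=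
  (Aff S).add_mem hf hg

theorem Aff.sub (hf : f ∈ Aff S) (hg : g ∈ Aff S) : (fun x => f x - g x) ∈ Aff S :=
  (Aff S).sub_mem hf hg

theorem Aff.mul (c : ℝ) (hf : f ∈ Aff S) : (fun x => c * f x) ∈ Aff S :=
  (Aff S).smul_mem c hf

theorem Aff.sum {ι : Type*} (s : Finset ι) (F : ι → X → ℝ) (h : ∀ i ∈ s, F i ∈ Aff S) :
    (fun x => ∑ i ∈ s, F i x) ∈ Aff S :=
  Aff.congr ((Aff S).sum_mem h) (by intro x; simp)

theorem Aff.le (h : T ⊆ Aff S) : Aff T ≤ Aff S := by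
  refine Submodule.span_le.2 ?_
  rintro f (rfl | hf)
  · exact Aff.one
  · exact h hf

theorem Aff.mono (h : T ⊆ S) : Aff T ≤ Aff S := Aff.le (h.trans Aff.sub_set)

theorem Step.pre (h : Step w S T) (hS : S ⊆ Aff R) : Step w R T := by
  obtain ⟨G, h1, h2, h3⟩ := h
  exact ⟨G, h1, fun g hg => Aff.le hS (h2 g hg), h3⟩

theorem Step.post (h : Step w S T) (hT : R ⊆ Aff T) : Step w S R := by
  obtain ⟨G, h1, h2, h3⟩ := h
  exact ⟨G, h1, h2, fun g hg => Aff.le h3 (hT hg)⟩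

theorem Step.width (h : Step w₁ S T) (hw : w₁ ≤ w₂) : Step w₂ S T := by
  obtain ⟨G, h1, h2, h3⟩ := h
  exact ⟨G, h1.trans hw, h2, h3⟩

theorem Step.union (h₁ : Step w₁ S T₁) (h₂ : Step w₂ S T₂) : Step (w₁ + w₂) S (T₁ ∪ T₂) := by
  obtain ⟨G, h1, h2, h3⟩ := h₁
  obtain ⟨G', h1', h2', h3'⟩ := h₂
  refine ⟨G ∪ G', (card_union_le _ _).trans (add_le_add h1 h1'), ?_, ?_⟩
  · intro g hg
    rcases Finset.mem_union.1 hg with h | h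
    exacts [h2 g h, h2' g h]
  · rw [Finset.coe_union, Set.image_union]
    exact Set.union_subset (h3.trans (Aff.mono Set.subset_union_left))
      (h3'.trans (Aff.mono Set.subset_union_right))

theorem Step.finset {ι : Type*} (s : Finset ι) (F : ι → Set (X → ℝ))
    (h : ∀ i ∈ s, Step w S (F i)) : Step (s.card * w) S (⋃ i ∈ s, F i) := by
  induction s using Finset.induction_on with
  | empty => exact ⟨∅, by simp, by simp, by simp⟩
  | insert a s ha ih =>
    rw [Finset.set_biUnion_insert, Finset.card_insert_of_notMem ha, add_mul, one_mul, add_comm]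
    exact (h a (by simp)).union (ih fun i hi => h i (by simp [hi]))

theorem Step.iUnion {ι : Type*} [Fintype ι] (F : ι → Set (X → ℝ))
    (h : ∀ i, Step w S (F i)) : Step (Fintype.card ι * w) S (⋃ i, F i) := by
  have := Step.finset (w := w) (S := S) Finset.univ F (fun i _ => h i)
  simpa using this

theorem Step.relu (h : f ∈ Aff S) : Step 1 S {RN.relu f} :=
  ⟨{f}, by simp, by simpa using h, by simpa using Aff.self (by simp)⟩

theorem Step.carry (h : f ∈ Aff S) (C : ℝ) (hC : ∀ x, C ≤ f x) : Step 1 S {f} := by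
  refine (Step.relu (Aff.sub h (Aff.const C))).post ?_
  rintro _ rfl
  refine Aff.congr (Aff.add (Aff.self (Set.mem_singleton _)) (Aff.const C)) ?_
  intro x
  simp only [RN.relu]
  rw [max_eq_left (by linarith [hC x])]; ring

theorem Step.carry0 (h : f ∈ Aff S) (hC : ∀ x, 0 ≤ f x) : Step 1 S {f} := Step.carry h 0 hC

theorem Step.signed (h : f ∈ Aff S) : Step 2 S {f} := by
  refine ((Step.relu h).union (Step.relu (Aff.mul (-1) h))).post ?_
  intro g hg
  rw [Set.mem_singleton_iff.1 hg]
  refine Aff.congr (Aff.sub (Aff.self (Or.inl rfl)) (Aff.self (Or.inr rfl))) ?_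
  intro x
  simp only [RN.relu]
  rcases le_total (f x) 0 with h | h
  · rw [max_eq_right h, max_eq_left (by linarith)]; ring
  · rw [max_eq_left h, max_eq_right (by linarith)]; ring

theorem Step.thresh (h : f ∈ Aff S) (τ δ : ℝ) (hδ : 0 < δ) (hf : ∀ x, τ ≤ f x ∨ f x ≤ τ - δ) :
    Step 2 S {fun x => if τ ≤ f x then 1 else 0} := by
  refine ((Step.relu (Aff.sub h (Aff.const (τ - δ)))).union
    (Step.relu (Aff.sub h (Aff.const τ)))).post ?_
  rintro _ rfl
  refine Aff.congr (Aff.mul δ⁻¹ (Aff.sub (Aff.self (Or.inl rfl)) (Aff.self (Or.inr rfl)))) ?_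
  intro x
  simp only [RN.relu]
  rcases hf x with h | h
  · rw [if_pos h, max_eq_left (by linarith), max_eq_left (by linarith)]; field_simp; ring
  · rw [if_neg (by linarith), max_eq_right (by linarith), max_eq_right (by linarith)]; ring

theorem Steps.pre (h : Steps w l S T) (hS : S ⊆ Aff R) : Steps w l R T := by
  cases l with
  | zero => exact fun f hf => Aff.le hS (h hf)
  | succ l =>
    obtain ⟨Q, h1, h2⟩ := h
    exact ⟨Q, h1.pre hS, h2⟩

theorem Steps.post (h : Steps w l S T) (hT : R ⊆ Aff T) : Steps w l S R := by
  induction l generalizing S with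
  | zero => exact fun f hf => Aff.le h (hT hf)
  | succ l ih =>
    obtain ⟨Q, h1, h2⟩ := h
    exact ⟨Q, h1, ih h2⟩

theorem Steps.width (h : Steps w₁ l S T) (hw : w₁ ≤ w₂) : Steps w₂ l S T := by
  induction l generalizing S with
  | zero => exact h
  | succ l ih =>
    obtain ⟨Q, h1, h2⟩ := h
    exact ⟨Q, h1.width hw, ih h2⟩

theorem Steps.trans (h₁ : Steps w l₁ S R) (h₂ : Steps w l₂ R T) : Steps w (l₁ + l₂) S T := by
  induction l₁ generalizing S with
  | zero => rw [zero_add]; exact h₂.pre h₁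
  | succ l ih =>
    obtain ⟨Q, h1, h2⟩ := h₁
    rw [Nat.succ_add]
    exact ⟨Q, h1, ih h2⟩

theorem Step.steps (h : Step w S T) : Steps w 1 S T := ⟨T, h, Aff.sub_set⟩

theorem Steps.union (h₁ : Steps w₁ l S T₁) (h₂ : Steps w₂ l S T₂) :
    Steps (w₁ + w₂) l S (T₁ ∪ T₂) := by
  suffices H : ∀ l (S S' : Set (X → ℝ)), Steps w₁ l S T₁ → Steps w₂ l S' T₂ →
      Steps (w₁ + w₂) l (S ∪ S') (T₁ ∪ T₂) by
    have := H l S S h₁ h₂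
    rwa [Set.union_self] at this
  intro l
  induction l with
  | zero =>
    intro S S' h h'
    have h₀ : T₁ ⊆ Aff S := h
    have h₀' : T₂ ⊆ Aff S' := h'
    exact Set.union_subset (h₀.trans (Aff.mono Set.subset_union_left))
      (h₀'.trans (Aff.mono Set.subset_union_right))
  | succ l ih =>
    rintro S S' ⟨Q, h1, h2⟩ ⟨Q', h1', h2'⟩
    exact ⟨Q ∪ Q', (h1.pre (Set.subset_union_left.trans Aff.sub_set)).union
      (h1'.pre (Set.subset_union_right.trans Aff.sub_set)), ih _ _ h2 h2'⟩

theorem Steps.empty : Steps 0 l S ∅ := by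
  induction l generalizing S with
  | zero => exact Set.empty_subset _
  | succ l ih => exact ⟨∅, ⟨∅, by simp, by simp, by simp⟩, ih⟩

theorem Steps.iUnion {ι : Type*} [Fintype ι] (F : ι → Set (X → ℝ))
    (h : ∀ i, Steps w l S (F i)) : Steps (Fintype.card ι * w) l S (⋃ i, F i) := by
  have : ∀ s : Finset ι, Steps (s.card * w) l S (⋃ i ∈ s, F i) := by
    intro s
    induction s using Finset.induction_on with
    | empty => simpa using Steps.empty
    | insert a s ha ih =>
      rw [Finset.set_biUnion_insert, Finset.card_insert_of_notMem ha, add_mul, one_mul, add_comm]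
      exact (h a).union ih
  simpa using this Finset.univ

theorem Steps.carry (h : f ∈ Aff S) (C : ℝ) (hC : ∀ x, C ≤ f x) : Steps 1 l S {f} := by
  induction l generalizing S with
  | zero => simpa [Steps] using h
  | succ l ih => exact ⟨{f}, Step.carry h C hC, ih (Aff.self rfl)⟩

theorem Steps.sum {ρ : Type*} [Fintype ρ] (C : Set (X → ℝ)) (r w₀ N : ℕ) (hC : Step r C C)
    (q : ℕ → ρ → X → ℝ) (hq0 : ∀ t k x, 0 ≤ q t k x)
    (hq : ∀ t, Step w₀ C (Set.range (q t))) :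
    Steps (r + w₀ + Fintype.card ρ) N C
      (C ∪ Set.range (fun k x => ∑ t ∈ range N, q t k x)) := by
  induction N with
  | zero =>
    refine Set.union_subset Aff.sub_set ?_
    rintro _ ⟨k, rfl⟩
    exact Aff.congr (Aff.const 0) (by simp)
  | succ N ih =>
    refine ih.trans (Step.steps ?_)
    have h1 : Step r (C ∪ Set.range (fun k x => ∑ t ∈ range N, q t k x)) C :=
      hC.pre (Set.subset_union_left.trans Aff.sub_set)
    have h2 : Step w₀ (C ∪ Set.range (fun k x => ∑ t ∈ range N, q t k x)) (Set.range (q N)) :=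
      (hq N).pre (Set.subset_union_left.trans Aff.sub_set)
    have h3 : Step (Fintype.card ρ * 1) (C ∪ Set.range (fun k x => ∑ t ∈ range N, q t k x))
        (⋃ k, {fun x => ∑ t ∈ range N, q t k x}) :=
      Step.iUnion _ (fun k => Step.carry0 (Aff.self (Or.inr ⟨k, rfl⟩))
        (fun x => Finset.sum_nonneg fun t _ => hq0 t k x))
    rw [mul_one] at h3
    refine ((h1.union h2).union h3).post (Set.union_subset ?_ ?_)
    · exact fun f hf => Aff.self (Or.inl (Or.inl hf))
    · rintro _ ⟨k, rfl⟩
      refine Aff.congr (Aff.add (Aff.self (Or.inr (Set.mem_iUnion.2 ⟨k, rfl⟩)))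
        (Aff.self (Or.inl (Or.inr ⟨k, rfl⟩)))) ?_
      intro x
      simp [Finset.sum_range_succ]

theorem sum_blocks (h : ℕ → ℝ) (N c : ℕ) :
    ∑ t ∈ range N, ∑ k ∈ range c, h (t * c + k) = ∑ j ∈ range (N * c), h j := by
  induction N with
  | zero => simp
  | succ N ih => rw [Finset.sum_range_succ, ih, Nat.succ_mul, Finset.sum_range_add]

theorem Steps.count {ρ : Type*} [Fintype ρ] (y : X → ℝ) (C : ℝ) (hC : ∀ x, C ≤ y x) (c N : ℕ)
    (τ : ℕ → ℝ) (δ : ℝ) (hδ : 0 < δ) (hτ : ∀ j x, τ j ≤ y x ∨ y x ≤ τ j - δ)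
    (a : ρ → ℕ → ℝ) (ha : ∀ k j, 0 ≤ a k j) :
    Steps (1 + 2 * c + Fintype.card ρ) N {y}
      ({y} ∪ Set.range (fun k x => ∑ j ∈ range (N * c), a k j * (if τ j ≤ y x then 1 else 0))) := by
  have key := Steps.sum (ρ := ρ) {y} 1 (2 * c) N
    (Step.carry (f := y) (Aff.self (Set.mem_singleton y)) C hC)
    (fun t k x => ∑ i ∈ range c, a k (t * c + i) * (if τ (t * c + i) ≤ y x then 1 else 0))
    (by
      intro t k x
      refine Finset.sum_nonneg fun i _ => mul_nonneg (ha _ _) ?_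
      split_ifs <;> norm_num)
    (by
      intro t
      have := Step.finset (S := {y}) (w := 2) (range c)
        (fun i => {fun x => if τ (t * c + i) ≤ y x then 1 else 0})
        (fun i _ => Step.thresh (f := y) (Aff.self (Set.mem_singleton y)) _ δ hδ (hτ _))
      rw [Finset.card_range, mul_comm] at this
      refine this.post ?_
      rintro _ ⟨k, rfl⟩
      refine Aff.sum (range c)
        (fun i x => a k (t * c + i) * (if τ (t * c + i) ≤ y x then 1 else 0)) ?_
      intro i hi
      refine Aff.mul (f := fun x => if τ (t * c + i) ≤ y x then 1 else 0) _ (Aff.self ?_)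
      exact Set.mem_iUnion₂.2 ⟨i, hi, rfl⟩)
  refine key.post (Set.union_subset (fun f hf => Aff.self (Or.inl hf)) ?_)
  rintro _ ⟨k, rfl⟩
  refine Aff.congr (Aff.self (Or.inr ⟨k, rfl⟩)) ?_
  intro x
  exact (sum_blocks (fun j => a k j * (if τ j ≤ y x then 1 else 0)) N c).symm

end basic

section pull
variable {X Y : Type*} {w l : ℕ}

/-- Pull back a set of functions. -/
def pull (ρ : X → Y) (S : Set (Y → ℝ)) : Set (X → ℝ) := (fun f => f ∘ ρ) '' S

theorem Aff.pull (ρ : X → Y) {S : Set (Y → ℝ)} {f : Y → ℝ} (h : f ∈ Aff S) :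
    f ∘ ρ ∈ Aff (pull ρ S) := by
  have : Aff S ≤ (Aff (RN.pull ρ S)).comap (LinearMap.funLeft ℝ ℝ ρ) := by
    refine Submodule.span_le.2 ?_
    rintro g (rfl | hg)
    · exact Aff.one
    · exact Aff.self ⟨g, hg, rfl⟩
  exact this h

theorem Aff.lift (ρ : X → Y) {S : Set (Y → ℝ)} {f : X → ℝ} (h : f ∈ Aff (RN.pull ρ S)) :
    ∃ g ∈ Aff S, g ∘ ρ = f := by
  have : Aff (RN.pull ρ S) ≤ (Aff S).map (LinearMap.funLeft ℝ ℝ ρ) := by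
    refine Submodule.span_le.2 ?_
    rintro g (rfl | ⟨g, hg, rfl⟩)
    · exact ⟨1, Aff.one, rfl⟩
    · exact ⟨g, Aff.self hg, rfl⟩
  obtain ⟨g, h1, h2⟩ := this h
  exact ⟨g, h1, h2⟩

theorem Step.pull (ρ : X → Y) {S T : Set (Y → ℝ)} (h : Step w S T) :
    Step w (pull ρ S) (pull ρ T) := by
  obtain ⟨G, h1, h2, h3⟩ := h
  refine ⟨G.image (fun f => f ∘ ρ), card_image_le.trans h1, ?_, ?_⟩
  · intro g' hg'
    obtain ⟨g, hg, rfl⟩ := Finset.mem_image.1 hg'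
    exact Aff.pull ρ (h2 g hg)
  · rintro _ ⟨f, hf, rfl⟩
    refine Aff.mono ?_ (Aff.pull ρ (h3 hf))
    rintro _ ⟨_, ⟨g, hg, rfl⟩, rfl⟩
    exact ⟨g ∘ ρ, by simpa using ⟨g, hg, rfl⟩, rfl⟩

theorem Steps.pull (ρ : X → Y) {S T : Set (Y → ℝ)} (h : Steps w l S T) :
    Steps w l (pull ρ S) (pull ρ T) := by
  induction l generalizing S with
  | zero =>
    rintro _ ⟨f, hf, rfl⟩
    exact Aff.pull ρ (h hf)
  | succ l ih =>
    obtain ⟨R, h1, h2⟩ := h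
    exact ⟨_, h1.pull ρ, ih h2⟩

theorem Step.lift (ρ : X → Y) {S : Set (Y → ℝ)} {T : Set (X → ℝ)}
    (h : Step w (RN.pull ρ S) T) : ∃ T', Step w S T' ∧ T ⊆ Aff (RN.pull ρ T') := by
  obtain ⟨G, h1, h2, h3⟩ := h
  have hl : ∀ g, ∃ g', g ∈ G → g' ∈ Aff S ∧ g' ∘ ρ = g := by
    intro g
    by_cases hg : g ∈ G
    · obtain ⟨g', h1, h2⟩ := Aff.lift ρ (h2 g hg)
      exact ⟨g', fun _ => ⟨h1, h2⟩⟩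
    · exact ⟨0, fun h => absurd h hg⟩
  choose e he using hl
  refine ⟨RN.relu '' ((G.image e : Finset (Y → ℝ)) : Set (Y → ℝ)),
    ⟨G.image e, card_image_le.trans h1, ?_, Aff.sub_set⟩, h3.trans (Aff.mono ?_)⟩
  · intro g' hg'
    obtain ⟨g, hg, rfl⟩ := Finset.mem_image.1 hg'
    exact (he g hg).1
  · rintro _ ⟨g, hg, rfl⟩
    have hm : e g ∈ ((G.image e : Finset (Y → ℝ)) : Set (Y → ℝ)) :=
      Finset.mem_coe.2 (Finset.mem_image_of_mem e hg)
    refine ⟨RN.relu (e g), ⟨e g, hm, rfl⟩, ?_⟩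
    funext x
    have := congrFun (he g hg).2 x
    simp only [RN.relu, Function.comp] at this ⊢
    rw [this]

theorem Steps.lift (ρ : X → Y) {S : Set (Y → ℝ)} {f : X → ℝ}
    (h : Steps w l (RN.pull ρ S) {f}) : ∃ g, Steps w l S {g} ∧ g ∘ ρ = f := by
  induction l generalizing S with
  | zero =>
    obtain ⟨g, h1, h2⟩ := Aff.lift ρ (h rfl)
    exact ⟨g, by simpa [Steps] using h1, h2⟩
  | succ l ih =>
    obtain ⟨R, h1, h2⟩ := h
    obtain ⟨T', h3, h4⟩ := Step.lift ρ h1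
    obtain ⟨g, h5, h6⟩ := ih (h2.pre h4)
    exact ⟨g, ⟨T', h3, h5⟩, h6⟩

end pull


section arith

theorem sum_ind (Q m : ℕ) (h : m ≤ Q) (p : ℕ → Prop) [DecidablePred p] (hp : ∀ j, p j ↔ j + 1 ≤ m) (a : ℕ → ℝ) :
    ∑ j ∈ range Q, a j * (if p j then 1 else 0) = ∑ j ∈ range m, a j := by
  have h1 : ∀ j ∈ range Q, a j * (if p j then 1 else 0) = if j < m then a j else 0 := by
    intro j _
    by_cases hj : j < m
    · rw [if_pos ((hp j).2 hj), if_pos hj, mul_one]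
    · rw [if_neg (fun h => hj ((hp j).1 h)), if_neg hj, mul_zero]
  rw [Finset.sum_congr rfl h1, ← Finset.sum_filter]
  congr 1
  ext j
  simp only [Finset.mem_filter, Finset.mem_range]
  omega

theorem sum_odd (m : ℕ) : ∑ j ∈ range m, (2 * (j : ℝ) + 1) = (m : ℝ) ^ 2 := by
  induction m with
  | zero => simp
  | succ m ih => rw [Finset.sum_range_succ, ih]; push_cast; ring

end arith

section coord
variable {X : Type*}

theorem coord (y : X → ℝ) (hy : ∀ x, -1 ≤ y x)
    (hg : ∀ x (j : ℕ), 1 ≤ j → (j : ℝ) ≤ y x ∨ y x ≤ j - 1 / 4) (c L N : ℕ) (hN0 : N ≠ 0)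
    (hN : ∀ x, y x < N) (hNQ : N ≤ (L * c) * (L * c)) :
    Steps (2 * c + 3) (2 * L) {y} {fun x => ((⌊y x⌋₊ : ℕ) : ℝ)} := by
  set Q := L * c with hQ
  have hQ0 : 0 < Q := by
    rcases Nat.eq_zero_or_pos Q with h | h
    · rw [h] at hNQ; omega
    · exact h
  have hfl : ∀ x, ⌊y x⌋₊ < Q * Q := fun x =>
    lt_of_lt_of_le ((Nat.floor_lt' hN0).2 (hN x)) hNQ
  set u : X → ℝ := fun x => ((⌊y x⌋₊ / Q : ℕ) : ℝ) with hu
  have huQ : ∀ x, ⌊y x⌋₊ / Q ≤ Q := fun x => (Nat.div_lt_of_lt_mul (hfl x)).le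
  have s1 := Steps.count (ρ := Unit) y (-1) hy c L (fun j => (((j + 1) * Q : ℕ) : ℝ)) (1 / 4)
    (by norm_num) (fun j x => hg x _ (Nat.mul_pos (Nat.succ_pos j) hQ0)) (fun _ _ => 1)
    (by intros; norm_num)
  have s1' : Steps (2 * c + 3) L {y} ({y} ∪ {u}) := by
    refine (s1.post ?_).width (by simp; omega)
    refine Set.union_subset (fun f hf => Aff.self (Or.inl hf)) ?_
    intro f hf
    rw [Set.mem_singleton_iff.1 hf]
    refine Aff.congr (Aff.self (Or.inr ⟨(), rfl⟩)) ?_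
    intro x
    have := sum_ind Q (⌊y x⌋₊ / Q) (huQ x) (fun j => (((j + 1) * Q : ℕ) : ℝ) ≤ y x) (by
      intro j
      rw [← Nat.le_floor_iff' (Nat.mul_pos (Nat.succ_pos j) hQ0).ne', Nat.le_div_iff_mul_le hQ0])
      (fun _ => 1)
    simp only [hu]
    refine Eq.trans ?_ this.symm
    simp
  set r : X → ℝ := fun x => y x - Q * u x with hr
  have hcast : ∀ x, ∀ n : ℕ, (n : ℝ) ≤ r x ↔ ((Q * (⌊y x⌋₊ / Q) + n : ℕ) : ℝ) ≤ y x := by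
    intro x n
    simp only [hr, hu]
    push_cast
    constructor <;> intro h <;> linarith
  have hr1 : ∀ x, -1 ≤ r x := by
    intro x
    rcases Nat.eq_zero_or_pos (⌊y x⌋₊) with h | h
    · have := hy x
      simp only [hr, hu, h]
      simpa using this
    · have h1 : Q * (⌊y x⌋₊ / Q) ≤ ⌊y x⌋₊ := Nat.mul_div_le _ _
      have h2 : ((0 : ℕ) : ℝ) ≤ r x := by
        rw [hcast]
        have h3 : ((⌊y x⌋₊ : ℕ) : ℝ) ≤ y x := (Nat.le_floor_iff' h.ne').1 le_rfl
        refine le_trans ?_ h3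
        exact_mod_cast h1
      push_cast at h2
      linarith
  have s2 := Steps.count (ρ := Unit) r (-1) hr1 c L (fun j => (((j + 1) : ℕ) : ℝ)) (1 / 4)
    (by norm_num) (by
      intro j x
      rcases hg x (Q * (⌊y x⌋₊ / Q) + (j + 1)) (by omega) with h | h
      · left
        exact (hcast x _).2 h
      · right
        simp only [hr, hu]
        push_cast at h ⊢
        linarith) (fun _ _ => 1) (by intros; norm_num)
  have s2' : Steps (2 * c + 3) L ({y} ∪ {u}) {fun x => ((⌊y x⌋₊ : ℕ) : ℝ)} := by
    have hrm : r ∈ Aff ({y} ∪ {u}) := Aff.sub (Aff.self (Or.inl rfl))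
      (Aff.mul _ (Aff.self (Or.inr rfl)))
    have hum : u ∈ Aff ({y} ∪ {u}) := Aff.self (Or.inr rfl)
    have s3 := (s2.pre (R := {y} ∪ {u}) (by
      intro f hf
      rw [Set.mem_singleton_iff.1 hf]
      exact hrm)).union (Steps.carry (l := L) hum 0 (fun x => by simp only [hu]; positivity))
    refine (s3.post ?_).width (by simp; omega)
    intro f hf
    rw [Set.mem_singleton_iff.1 hf]
    refine Aff.congr (Aff.add (Aff.mul Q (Aff.self (Or.inr rfl)))
      (Aff.self (Or.inl (Or.inr ⟨(), rfl⟩)))) ?_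
    intro x
    have := sum_ind Q (⌊y x⌋₊ % Q) (Nat.mod_lt _ hQ0).le
      (fun j => (((j + 1) : ℕ) : ℝ) ≤ r x) (by
      intro j
      rw [hcast, ← Nat.le_floor_iff' (by omega)]
      have := Nat.div_add_mod (⌊y x⌋₊) Q
      omega)
      (fun _ => 1)
    have h5 : ((⌊y x⌋₊ : ℕ) : ℝ) = Q * u x + ((⌊y x⌋₊ % Q : ℕ) : ℝ) := by
      simp only [hu]
      exact_mod_cast (Nat.div_add_mod (⌊y x⌋₊) Q).symm
    rw [h5]
    congr 1
    refine Eq.trans ?_ this.symm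
    simp
  have := s1'.trans s2'
  rwa [← two_mul] at this

theorem bits_lt (β : ℕ → ℕ) (hβ : ∀ j, β j ≤ 1) (m : ℕ) :
    ∑ j ∈ range m, β j * 2 ^ j < 2 ^ m := by
  induction m with
  | zero => simp
  | succ m ih =>
    rw [Finset.sum_range_succ, pow_succ]
    have : β m * 2 ^ m ≤ 1 * 2 ^ m := Nat.mul_le_mul_right _ (hβ m)
    omega

theorem bits (b : X → ℕ) (β : ℕ → X → ℕ) (hβ : ∀ j x, β j x ≤ 1) (m : ℕ) :
    ∀ acc : X → ℝ, (∀ x, 0 ≤ acc x) →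
    Steps 7 (2 * m) ({fun x => ((∑ j ∈ range m, β j x * 2 ^ j : ℕ) : ℝ)} ∪ {fun x => (b x : ℝ)} ∪
      {acc})
      {fun x => acc x + ((∑ j ∈ range m, if j < b x then β j x else 0 : ℕ) : ℝ)} := by
  induction m with
  | zero =>
    intro acc _ f hf
    rw [Set.mem_singleton_iff.1 hf]
    exact Aff.congr (Aff.self (Or.inr rfl)) (by simp)
  | succ m ih =>
    intro acc hacc
    set Θ : X → ℝ := fun x => ((∑ j ∈ range (m + 1), β j x * 2 ^ j : ℕ) : ℝ) with hΘ
    set B : X → ℝ := fun x => (b x : ℝ) with hB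
    set Θ' : X → ℝ := fun x => ((∑ j ∈ range m, β j x * 2 ^ j : ℕ) : ℝ) with hΘ'
    have hΘm : Θ ∈ Aff ({Θ} ∪ {B} ∪ {acc}) := Aff.self (Or.inl (Or.inl rfl))
    have hBm : B ∈ Aff ({Θ} ∪ {B} ∪ {acc}) := Aff.self (Or.inl (Or.inr rfl))
    have ham : acc ∈ Aff ({Θ} ∪ {B} ∪ {acc}) := Aff.self (Or.inr rfl)
    have hdec : ∀ x, Θ x = Θ' x + 2 ^ m * (β m x : ℝ) := by
      intro x
      simp only [hΘ, hΘ', Finset.sum_range_succ]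
      push_cast; ring
    have hlt : ∀ x, Θ' x ≤ 2 ^ m - 1 := by
      intro x
      have := bits_lt (fun j => β j x) (fun j => hβ j x) m
      have h2 : ((∑ j ∈ range m, β j x * 2 ^ j : ℕ) : ℝ) + 1 ≤ 2 ^ m := by exact_mod_cast this
      simp only [hΘ']
      linarith
    have h0 : ∀ x, 0 ≤ Θ' x := fun x => Nat.cast_nonneg _
    have hcase : ∀ x, β m x = 0 ∨ β m x = 1 := fun x => by have := hβ m x; omega
    have a1 : Step 2 ({Θ} ∪ {B} ∪ {acc}) {fun x => (β m x : ℝ)} := by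
      have := Step.thresh hΘm (2 ^ m) 1 one_pos (by
        intro x
        have h1 := hdec x; have h2 := hlt x; have h3 := h0 x
        rcases hcase x with h | h
        · right; rw [h] at h1; push_cast at h1; linarith
        · left; rw [h] at h1; push_cast at h1; linarith)
      refine this.post ?_
      intro f hf
      rw [Set.mem_singleton_iff.1 hf]
      refine Aff.congr (Aff.self rfl) ?_
      intro x
      have h1 := hdec x; have h2 := hlt x; have h3 := h0 x
      rcases hcase x with h | h
      · rw [h] at h1 ⊢; push_cast at h1 ⊢; rw [if_neg (by linarith)]
      · rw [h] at h1 ⊢; push_cast at h1 ⊢; rw [if_pos (by linarith)]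
    have a2 := Step.thresh hBm ((m + 1 : ℕ) : ℝ) 1 one_pos (by
      intro x
      simp only [hB]
      rcases Nat.lt_or_ge m (b x) with h | h
      · left; exact_mod_cast h
      · right
        have : (b x : ℝ) ≤ m := by exact_mod_cast h
        push_cast; linarith)
    set I : X → ℝ := fun x => if ((m + 1 : ℕ) : ℝ) ≤ B x then 1 else 0 with hI
    have a3 : Step 1 ({Θ} ∪ {B} ∪ {acc}) {Θ} := Step.carry0 hΘm (fun x => Nat.cast_nonneg _)
    have a4 : Step 1 ({Θ} ∪ {B} ∪ {acc}) {B} := Step.carry0 hBm (fun x => Nat.cast_nonneg _)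
    have a5 : Step 1 ({Θ} ∪ {B} ∪ {acc}) {acc} := Step.carry0 ham hacc
    have A := (((a1.union a2).union a3).union a4).union a5
    set V := ({fun x => (β m x : ℝ)} ∪ {I} ∪ {Θ} ∪ {B} ∪ {acc} : Set (X → ℝ)) with hV
    have v1 : (fun x => (β m x : ℝ)) ∈ Aff V := Aff.self (Or.inl (Or.inl (Or.inl (Or.inl rfl))))
    have v2 : I ∈ Aff V := Aff.self (Or.inl (Or.inl (Or.inl (Or.inr rfl))))
    have v3 : Θ ∈ Aff V := Aff.self (Or.inl (Or.inl (Or.inr rfl)))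
    have v4 : B ∈ Aff V := Aff.self (Or.inl (Or.inr rfl))
    have v5 : acc ∈ Aff V := Aff.self (Or.inr rfl)
    have v6 : Θ' ∈ Aff V := by
      refine Aff.congr (Aff.sub v3 (Aff.mul (2 ^ m) v1)) ?_
      intro x
      have := hdec x
      linarith
    have b1 := Step.relu (Aff.sub (Aff.add v1 v2) (Aff.const 1))
    have b2 : Step 1 V {Θ'} := Step.carry0 v6 h0
    have b3 : Step 1 V {B} := Step.carry0 v4 (fun x => Nat.cast_nonneg _)
    have b4 : Step 1 V {acc} := Step.carry0 v5 hacc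
    have Bs := ((b1.union b2).union b3).union b4
    set acc' : X → ℝ := fun x => acc x + ((if m < b x then β m x else 0 : ℕ) : ℝ) with hacc'
    have fin := ih acc' (fun x => add_nonneg (hacc x) (Nat.cast_nonneg _))
    have B' : Step 7 V ({Θ'} ∪ {B} ∪ {acc'}) := by
      refine (Bs.post ?_).width (by norm_num)
      refine Set.union_subset (Set.union_subset ?_ ?_) ?_
      · exact fun f hf => Aff.self (Or.inl (Or.inl (Or.inr hf)))
      · exact fun f hf => Aff.self (Or.inl (Or.inr hf))
      · intro f hf
        rw [Set.mem_singleton_iff.1 hf]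
        refine Aff.congr (Aff.add (Aff.self (Or.inr rfl))
          (Aff.self (Or.inl (Or.inl (Or.inl rfl))))) ?_
        intro x
        simp only [hacc', relu, hI, hB]
        congr 1
        rcases hcase x with h | h <;> by_cases h' : m < b x
        · rw [h, if_pos h', if_pos (by exact_mod_cast h')]; norm_num
        · rw [h, if_neg h', if_neg (by exact_mod_cast h')]; norm_num
        · rw [h, if_pos h', if_pos (by exact_mod_cast h')]; norm_num
        · rw [h, if_neg h', if_neg (by exact_mod_cast h')]; norm_num
    have tot := (Step.steps (A.width (by norm_num : _ ≤ 7))).trans (B'.steps.trans fin)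
    rw [show 2 * (m + 1) = 1 + (1 + 2 * m) by ring]
    refine tot.post ?_
    intro f hf
    rw [Set.mem_singleton_iff.1 hf]
    refine Aff.congr (Aff.self rfl) ?_
    intro x
    simp only [hacc', Finset.sum_range_succ]
    push_cast; ring

end coord


section fitting
variable {X : Type*}

theorem bound_exists (G : Fin 2 → ℕ → ℕ → ℕ) (P Q : ℕ) :
    ∃ C : ℕ, ∀ k, ∀ p < P, ∀ q < Q, G k p q ≤ C := by
  refine ⟨∑ k, ∑ p ∈ range P, ∑ q ∈ range Q, G k p q, ?_⟩
  intro k p hp q hq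
  have h1 : G k p q ≤ ∑ q ∈ range Q, G k p q :=
    Finset.single_le_sum (f := fun q => G k p q) (fun _ _ => Nat.zero_le _) (mem_range.2 hq)
  have h2 : ∑ q ∈ range Q, G k p q ≤ ∑ p ∈ range P, ∑ q ∈ range Q, G k p q :=
    Finset.single_le_sum (f := fun p => ∑ q ∈ range Q, G k p q)
      (fun _ _ => Nat.zero_le _) (mem_range.2 hp)
  have h3 : ∑ p ∈ range P, ∑ q ∈ range Q, G k p q ≤ ∑ k, ∑ p ∈ range P, ∑ q ∈ range Q, G k p q :=
    Finset.single_le_sum (f := fun k => ∑ p ∈ range P, ∑ q ∈ range Q, G k p q)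
      (fun _ _ => Nat.zero_le _) (mem_univ k)
  exact h1.trans (h2.trans h3)

theorem select (u v b : X → ℕ) (W L : ℕ) (e : ℕ → X → ℝ)
    (he : ∀ k x, e k x = if k + 1 ≤ v x then 1 else 0)
    (hu : ∀ x, u x < L * W) (hv : ∀ x, v x < W) (G : Fin 2 → ℕ → ℕ → ℕ) :
    Steps (3 * W + 5) L
      ((⋃ k ∈ range W, {e k}) ∪ {fun x => (u x : ℝ)} ∪ {fun x => (u x : ℝ) ^ 2} ∪
        {fun x => (b x : ℝ)})
      ({fun x => (b x : ℝ)} ∪ Set.range (fun k x => ((G k (u x) (v x) : ℕ) : ℝ))) := by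
  obtain ⟨C, hC⟩ := bound_exists G (L * W) W
  set S : Set (X → ℝ) := ((⋃ k ∈ range W, {e k}) ∪ {fun x => (u x : ℝ)} ∪
    {fun x => (u x : ℝ) ^ 2} ∪ {fun x => (b x : ℝ)}) with hS
  have m1 : ∀ k ∈ range W, e k ∈ Aff S := fun k hk =>
    Aff.self (Or.inl (Or.inl (Or.inl (Set.mem_iUnion₂.2 ⟨k, hk, rfl⟩))))
  have m2 : (fun x => (u x : ℝ)) ∈ Aff S := Aff.self (Or.inl (Or.inl (Or.inr rfl)))
  have m3 : (fun x => (u x : ℝ) ^ 2) ∈ Aff S := Aff.self (Or.inl (Or.inr rfl))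
  have m4 : (fun x => (b x : ℝ)) ∈ Aff S := Aff.self (Or.inr rfl)
  have he0 : ∀ k x, 0 ≤ e k x := by
    intro k x
    rw [he]; split_ifs <;> norm_num
  have hSS : Step (W + 3) S S := by
    have c1 := Step.finset (S := S) (w := 1) (range W) (fun k => {e k})
      (fun k hk => Step.carry0 (m1 k hk) (he0 k))
    rw [card_range, mul_one] at c1
    have c2 := Step.carry0 m2 (fun x => Nat.cast_nonneg _)
    have c3 := Step.carry0 m3 (fun x => by positivity)
    have c4 := Step.carry0 m4 (fun x => Nat.cast_nonneg _)
    exact ((c1.union c2).union c3).union c4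
  -- pre-activations
  set pre : Fin 2 → ℕ → X → ℝ := fun k p x =>
    (((G k p 0 : ℕ) : ℝ) + ∑ j ∈ range W, (((G k p (j + 1) : ℕ) : ℝ) - ((G k p j : ℕ) : ℝ)) * e j x)
      - (C : ℝ) * (((u x : ℝ) ^ 2 - (2 * p : ℝ) * (u x : ℝ)) + (p : ℝ) ^ 2) with hpre
  have hpm : ∀ k p, pre k p ∈ Aff S := by
    intro k p
    refine Aff.sub (Aff.add (Aff.const _) (Aff.sum _ _ fun j hj => Aff.mul _ (m1 j hj))) ?_
    exact Aff.mul _ (Aff.add (Aff.sub m3 (Aff.mul _ m2)) (Aff.const _))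
  have hval : ∀ k p x, p < L * W → relu (pre k p) x =
      if p = u x then ((G k (u x) (v x) : ℕ) : ℝ) else 0 := by
    intro k p x hp
    have h1 : pre k p x = ((G k p (v x) : ℕ) : ℝ) - C * ((u x : ℝ) - p) ^ 2 := by
      have h2 : ∑ j ∈ range W, (((G k p (j + 1) : ℕ) : ℝ) - ((G k p j : ℕ) : ℝ)) * e j x
          = ((G k p (v x) : ℕ) : ℝ) - ((G k p 0 : ℕ) : ℝ) := by
        rw [← Finset.sum_range_sub (fun j => ((G k p j : ℕ) : ℝ)) (v x),
          ← sum_ind W (v x) (hv x).le (fun j => j + 1 ≤ v x) (fun j => Iff.rfl)]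
        refine Finset.sum_congr rfl fun j _ => ?_
        rw [he]
      simp only [hpre, h2]
      ring
    simp only [relu, h1]
    split_ifs with h
    · rw [h]
      simp
    · refine max_eq_right ?_
      have h3 : (1 : ℝ) ≤ ((u x : ℝ) - p) ^ 2 := by
        have : (1 : ℤ) ≤ ((u x : ℤ) - p) ^ 2 := by
          have : ((u x : ℤ) - p) ≠ 0 := by omega
          have := sq_pos_of_ne_zero this
          omega
        exact_mod_cast this
      have h4 : ((G k p (v x) : ℕ) : ℝ) ≤ C := by exact_mod_cast hC k p hp (v x) (hv x)
      nlinarith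
  have key := Steps.sum (ρ := Fin 2) S (W + 3) (2 * W) L hSS
    (fun t k x => ∑ i ∈ range W, relu (pre k (t * W + i)) x)
    (fun t k x => Finset.sum_nonneg fun i _ => le_max_right _ _) (by
      intro t
      have c1 := fun k : Fin 2 => Step.finset (S := S) (w := 1) (range W)
        (fun i => {relu (pre k (t * W + i))}) (fun i _ => Step.relu (hpm k _))
      have c2 := Step.iUnion _ c1
      rw [card_range, mul_one, Fintype.card_fin] at c2
      refine c2.post ?_
      rintro _ ⟨k, rfl⟩
      refine Aff.sum _ _ fun i hi => Aff.self ?_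
      exact Set.mem_iUnion.2 ⟨k, Set.mem_iUnion₂.2 ⟨i, hi, rfl⟩⟩)
  refine (key.post ?_).width (by simp; omega)
  refine Set.union_subset (fun f hf => Aff.self (Or.inl (Or.inr hf))) ?_
  rintro _ ⟨k, rfl⟩
  refine Aff.congr (Aff.self (Or.inr ⟨k, rfl⟩)) ?_
  intro x
  have := sum_blocks (fun p => relu (pre k p) x) L W
  refine Eq.trans ?_ this.symm
  rw [Finset.sum_eq_single (u x)]
  · rw [hval k _ x (hu x), if_pos rfl]
  · intro p hp hpu
    rw [hval k p x (mem_range.1 hp), if_neg hpu]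
  · intro h
    exact absurd (mem_range.2 (hu x)) h

theorem fit (i : X → ℕ) (W L M : ℕ) (hW : 0 < W) (hM : 0 < M)
    (hi : ∀ x, i x < (L * W) * (W * M)) (z : ℕ → ℕ) (hz : ∀ k, z k ≤ z (k + 1) ∧ z (k + 1) ≤ z k + 1) :
    Steps (3 * W + 5) (L + (1 + (L + 2 * M))) {fun x => (i x : ℝ)} {fun x => (z (i x) : ℝ)} := by
  have hWM : 0 < W * M := Nat.mul_pos hW hM
  set u : X → ℕ := fun x => i x / (W * M) with hu
  set r : X → ℕ := fun x => i x % (W * M) with hr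
  set v : X → ℕ := fun x => r x / M with hv
  set b : X → ℕ := fun x => r x % M with hb
  have hur : ∀ x, i x = W * M * u x + r x := fun x => (Nat.div_add_mod _ _).symm
  have hvb : ∀ x, r x = M * v x + b x := fun x => (Nat.div_add_mod _ _).symm
  have hrl : ∀ x, r x < W * M := fun x => Nat.mod_lt _ hWM
  have hbl : ∀ x, b x < M := fun x => Nat.mod_lt _ hM
  have hul : ∀ x, u x < L * W := fun x => Nat.div_lt_of_lt_mul (by rw [mul_comm]; exact hi x)
  have hvl : ∀ x, v x < W := fun x => Nat.div_lt_of_lt_mul (by rw [mul_comm]; exact hrl x)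
  have nat_thr : ∀ (f : X → ℕ) (n : ℕ) (x : X), (n : ℝ) ≤ (f x : ℝ) ∨ (f x : ℝ) ≤ (n : ℝ) - 1 := by
    intro f n x
    rcases Nat.lt_or_ge (f x) n with h | h
    · right
      have : (f x : ℝ) + 1 ≤ n := by exact_mod_cast h
      linarith
    · left; exact_mod_cast h
  -- stage 1
  have s1 := Steps.count (ρ := Fin 2) (fun x => (i x : ℝ)) 0 (fun x => Nat.cast_nonneg _) W L
    (fun j => (((j + 1) * (W * M) : ℕ) : ℝ)) 1 one_pos (fun j x => nat_thr i _ x)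
    (fun k j => if k = 0 then 1 else 2 * (j : ℝ) + 1)
    (by intro k j; split_ifs <;> positivity)
  have s1' : Steps (3 * W + 5) L {fun x => (i x : ℝ)}
      ({fun x => (i x : ℝ)} ∪ {fun x => (u x : ℝ)} ∪ {fun x => (u x : ℝ) ^ 2}) := by
    have hp : ∀ x j, (((j + 1) * (W * M) : ℕ) : ℝ) ≤ (i x : ℝ) ↔ j + 1 ≤ u x := by
      intro x j
      rw [Nat.cast_le, hu, Nat.le_div_iff_mul_le hWM]
    refine (s1.post ?_).width (by simp; omega)
    refine Set.union_subset (Set.union_subset (fun f hf => Aff.self (Or.inl hf)) ?_) ?_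
    · intro f hf
      rw [Set.mem_singleton_iff.1 hf]
      refine Aff.congr (Aff.self (Or.inr ⟨0, rfl⟩)) ?_
      intro x
      refine Eq.trans ?_ (sum_ind (L * W) (u x) (hul x).le _ (hp x) _).symm
      simp
    · intro f hf
      rw [Set.mem_singleton_iff.1 hf]
      refine Aff.congr (Aff.self (Or.inr ⟨1, rfl⟩)) ?_
      intro x
      refine Eq.trans ?_ (sum_ind (L * W) (u x) (hul x).le _ (hp x) _).symm
      simp [sum_odd]
  -- stage 2
  set S1 : Set (X → ℝ) := ({fun x => (i x : ℝ)} ∪ {fun x => (u x : ℝ)} ∪ {fun x => (u x : ℝ) ^ 2})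
    with hS1
  set e : ℕ → X → ℝ := fun k x => if (((k + 1) * M : ℕ) : ℝ) ≤ (r x : ℝ) then 1 else 0 with he
  have he' : ∀ k x, e k x = if k + 1 ≤ v x then 1 else 0 := by
    intro k x
    simp only [he]
    refine if_congr ?_ rfl rfl
    rw [Nat.cast_le, hv, Nat.le_div_iff_mul_le hM]
  have mi : (fun x => (i x : ℝ)) ∈ Aff S1 := Aff.self (Or.inl (Or.inl rfl))
  have mu : (fun x => (u x : ℝ)) ∈ Aff S1 := Aff.self (Or.inl (Or.inr rfl))
  have mu2 : (fun x => (u x : ℝ) ^ 2) ∈ Aff S1 := Aff.self (Or.inr rfl)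
  have mr : (fun x => (r x : ℝ)) ∈ Aff S1 := by
    refine Aff.congr (Aff.sub mi (Aff.mul ((W * M : ℕ) : ℝ) mu)) ?_
    intro x
    have : (i x : ℝ) = ((W * M : ℕ) : ℝ) * u x + r x := by exact_mod_cast hur x
    linarith
  have s2 : Step (3 * W + 5) S1 ((⋃ k ∈ range W, {e k}) ∪ {fun x => (u x : ℝ)} ∪
      {fun x => (u x : ℝ) ^ 2} ∪ {fun x => (b x : ℝ)}) := by
    have c1 := Step.finset (S := S1) (w := 2) (range W) (fun k => {e k})
      (fun k hk => Step.thresh mr _ 1 one_pos (nat_thr r _))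
    rw [card_range] at c1
    have c2 := Step.carry0 mu (fun x => Nat.cast_nonneg _)
    have c3 := Step.carry0 mu2 (fun x => by positivity)
    have c4 := Step.carry0 mr (fun x => Nat.cast_nonneg _)
    refine ((((c1.union c2).union c3).union c4).post ?_).width (by omega)
    refine Set.union_subset (fun f hf => Aff.self (Or.inl hf)) ?_
    intro f hf
    rw [Set.mem_singleton_iff.1 hf]
    refine Aff.congr (Aff.sub (Aff.self (Or.inr rfl)) (Aff.mul (M : ℝ) (Aff.sum (range W) e
      fun k hk => Aff.self (Or.inl (Or.inl (Or.inl (Set.mem_iUnion₂.2 ⟨k, hk, rfl⟩))))))) ?_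
    intro x
    have h1 : ∑ k ∈ range W, e k x = v x := by
      have := sum_ind W (v x) (hvl x).le (fun j => j + 1 ≤ v x) (fun j => Iff.rfl) (fun _ => 1)
      simp only [one_mul] at this
      rw [Finset.sum_congr rfl (fun k _ => he' k x), this]
      simp
    have h2 : (r x : ℝ) = (M : ℝ) * v x + b x := by exact_mod_cast hvb x
    simp only [h1]
    linarith
  -- stage 3 and 4
  set β : ℕ → ℕ → ℕ → ℕ := fun j p q => z ((p * W + q) * M + j + 1) - z ((p * W + q) * M + j) with hβ
  have s3 := select u v b W L e he' hul hvl
    (fun k p q => if k = 0 then z ((p * W + q) * M) else ∑ j ∈ range M, β j p q * 2 ^ j)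
  have s4 := bits b (fun j x => β j (u x) (v x)) (by
      intro j x
      have := hz ((u x * W + v x) * M + j)
      simp only [hβ]
      omega) M (fun x => (z ((u x * W + v x) * M) : ℝ)) (fun x => Nat.cast_nonneg _)
  have s4' := s4.pre (R := {fun x => (b x : ℝ)} ∪ Set.range (fun k x =>
      (((fun (k : Fin 2) p q => if k = 0 then z ((p * W + q) * M) else
        ∑ j ∈ range M, β j p q * 2 ^ j) k (u x) (v x) : ℕ) : ℝ))) (by
    refine Set.union_subset (Set.union_subset ?_ (fun f hf => Aff.self (Or.inl hf))) ?_
    · intro f hf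
      rw [Set.mem_singleton_iff.1 hf]
      exact Aff.congr (Aff.self (Or.inr ⟨1, rfl⟩)) (by intro x; simp)
    · intro f hf
      rw [Set.mem_singleton_iff.1 hf]
      exact Aff.congr (Aff.self (Or.inr ⟨0, rfl⟩)) (by intro x; simp))
  refine (s1'.trans (s2.steps.trans (s3.trans (s4'.width (by omega))))).post ?_
  intro f hf
  rw [Set.mem_singleton_iff.1 hf]
  refine Aff.congr (Aff.self rfl) ?_
  intro x
  have hsum : ∀ B ≤ M, z ((u x * W + v x) * M + B) =
      z ((u x * W + v x) * M) + ∑ j ∈ range B, β j (u x) (v x) := by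
    intro B
    induction B with
    | zero => simp
    | succ B ih =>
      intro h
      have ih' := ih (by omega)
      rw [Finset.sum_range_succ]
      have := hz ((u x * W + v x) * M + B)
      have h6 : β B (u x) (v x) = z ((u x * W + v x) * M + B + 1) - z ((u x * W + v x) * M + B) := rfl
      rw [← add_assoc]
      omega
  have hix : i x = (u x * W + v x) * M + b x := by
    rw [hur x, hvb x]; ring
  have hfilt : ∑ j ∈ range M, (if j < b x then β j (u x) (v x) else 0) =
      ∑ j ∈ range (b x), β j (u x) (v x) := by
    rw [← Finset.sum_filter]
    congr 1
    ext j
    have := hbl x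
    simp only [Finset.mem_filter, Finset.mem_range]
    omega
  rw [hix, hsum _ (hbl x).le, hfilt]
  push_cast
  rfl

end fitting


section data

theorem quant (y : ℕ → ℝ) (ε : ℝ) (hε : 0 < ε) (hy : ∀ k, |y (k + 1) - y k| ≤ ε) :
    ∃ (z : ℕ → ℕ) (C : ℝ), (∀ k, z k ≤ z (k + 1) ∧ z (k + 1) ≤ z k + 1) ∧
      ∀ k, |y k - (2 * ε * z k - ε * k + C)| ≤ 2 * ε := by
  set s : ℕ → ℝ := fun k => (y k - y 0) / (2 * ε) + k / 2 with hs
  have h1 : ∀ k, s k ≤ s (k + 1) ∧ s (k + 1) ≤ s k + 1 := by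
    intro k
    have h := abs_le.1 (hy k)
    have e : s (k + 1) = s k + ((y (k + 1) - y k) / (2 * ε) + 1 / 2) := by
      simp only [hs]; push_cast; field_simp; ring
    have a1 : -(1 / 2) ≤ (y (k + 1) - y k) / (2 * ε) := by
      rw [le_div_iff₀ (by linarith)]; linarith
    have a2 : (y (k + 1) - y k) / (2 * ε) ≤ 1 / 2 := by
      rw [div_le_iff₀ (by linarith)]; linarith
    constructor <;> linarith
  have h0 : ∀ k, 0 ≤ s k := by
    intro k
    induction k with
    | zero => simp [hs]
    | succ k ih => exact ih.trans (h1 k).1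
  refine ⟨fun k => ⌊s k⌋₊, y 0, ?_, ?_⟩
  · intro k
    refine ⟨Nat.floor_le_floor (h1 k).1, ?_⟩
    rw [← Nat.floor_add_one (h0 k)]
    exact Nat.floor_le_floor (h1 k).2
  · intro k
    have a := Nat.floor_le (h0 k)
    have b := Nat.lt_floor_add_one (s k)
    have e : y k = 2 * ε * s k - ε * k + y 0 := by
      simp only [hs]; field_simp; ring
    rw [e, abs_le]
    constructor <;> nlinarith

/-- Linear index of a grid point. -/
def idx (N m : ℕ) (k : Fin (m + 1) → ℕ) : ℕ :=
  k 0 + 2 * N * ∑ j : Fin m, k j.succ * N ^ (j : ℕ)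

theorem row_eq (N m : ℕ) (k : Fin m → ℕ) (hk : ∀ j, k j < N) :
    ((finFunctionFinEquiv (fun j => (⟨k j, hk j⟩ : Fin N)) : Fin (N ^ m)) : ℕ)
      = ∑ j : Fin m, k j * N ^ (j : ℕ) := by
  rw [finFunctionFinEquiv_apply]

theorem idx_lt (N m : ℕ) (k : Fin (m + 1) → ℕ) (hk : ∀ j, k j < N) :
    idx N m k < 2 * N ^ (m + 1) := by
  have h := row_eq N m (fun j => k j.succ) (fun j => hk j.succ)
  have h2 := (finFunctionFinEquiv (fun j : Fin m => (⟨k j.succ, hk j.succ⟩ : Fin N))).2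
  unfold idx
  rw [← h]
  generalize ((finFunctionFinEquiv (fun j : Fin m => (⟨k j.succ, hk j.succ⟩ : Fin N)) :
    Fin (N ^ m)) : ℕ) = a at *
  have h0 := hk 0
  have : N * (a + 1) ≤ N * N ^ m := Nat.mul_le_mul_left _ h2
  rw [pow_succ]
  nlinarith

theorem idx_holder (N m : ℕ) (F : (Fin (m + 1) → ℝ) → ℝ) (ε α : ℝ) (hε : 0 < ε) (hα : 0 < α)
    (hα1 : α ≤ 1) (hF : ∀ y y', |F y - F y'| ≤ ε * ‖y - y'‖ ^ α)
    (k k' : Fin (m + 1) → ℕ) (hk : ∀ j, k j < N) (hk' : ∀ j, k' j < N) :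
    |F (fun j => (k j : ℝ)) - F (fun j => (k' j : ℝ))| ≤
      ε * |(idx N m k : ℝ) - (idx N m k' : ℝ)| := by
  have pw : ∀ n : ℕ, (n : ℝ) ^ α ≤ n := by
    intro n
    rcases Nat.eq_zero_or_pos n with h | h
    · rw [h]; simp [Real.zero_rpow hα.ne']
    · have : (1 : ℝ) ≤ n := by exact_mod_cast h
      calc (n : ℝ) ^ α ≤ (n : ℝ) ^ (1 : ℝ) := Real.rpow_le_rpow_of_exponent_le this hα1
        _ = n := Real.rpow_one _
  suffices H : ∃ n : ℕ, ‖(fun j => (k j : ℝ)) - (fun j => (k' j : ℝ))‖ ≤ n ∧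
      (n : ℝ) ≤ |(idx N m k : ℝ) - (idx N m k' : ℝ)| by
    obtain ⟨n, h1, h2⟩ := H
    refine (hF _ _).trans (mul_le_mul_of_nonneg_left ?_ hε.le)
    exact (Real.rpow_le_rpow (norm_nonneg _) h1 hα.le).trans ((pw n).trans h2)
  have hr := row_eq N m (fun j => k j.succ) (fun j => hk j.succ)
  have hr' := row_eq N m (fun j => k' j.succ) (fun j => hk' j.succ)
  by_cases hrow : ∑ j : Fin m, k j.succ * N ^ (j : ℕ) = ∑ j : Fin m, k' j.succ * N ^ (j : ℕ)
  · rw [← hr, ← hr'] at hrow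
    have h1 := finFunctionFinEquiv.injective (Fin.ext hrow)
    have h2 : ∀ j : Fin m, k j.succ = k' j.succ := by
      intro j
      have := congrFun h1 j
      simpa using this
    refine ⟨((k 0 : ℤ) - k' 0).natAbs, ?_, ?_⟩
    · refine (pi_norm_le_iff_of_nonneg (Nat.cast_nonneg _)).2 ?_
      intro j
      rw [Nat.cast_natAbs]
      refine Fin.cases ?_ (fun j => ?_) j
      · simp
      · simp [h2 j]
    · unfold idx
      rw [← hr, ← hr', hrow, Nat.cast_natAbs]
      push_cast
      apply le_of_eq
      congr 1
      ring
  · refine ⟨N, ?_, ?_⟩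
    · refine (pi_norm_le_iff_of_nonneg (Nat.cast_nonneg _)).2 ?_
      intro j
      have a : (k j : ℝ) < N := by exact_mod_cast hk j
      have a' : (k' j : ℝ) < N := by exact_mod_cast hk' j
      have b : (0 : ℝ) ≤ k j := Nat.cast_nonneg _
      have b' : (0 : ℝ) ≤ k' j := Nat.cast_nonneg _
      simp only [Pi.sub_apply, Real.norm_eq_abs]
      rw [abs_le]; constructor <;> linarith
    · unfold idx
      generalize ∑ j : Fin m, k j.succ * N ^ (j : ℕ) = p at *
      generalize ∑ j : Fin m, k' j.succ * N ^ (j : ℕ) = p' at *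
      have a : (k 0 : ℝ) < N := by exact_mod_cast hk 0
      have a' : (k' 0 : ℝ) < N := by exact_mod_cast hk' 0
      have b : (0 : ℝ) ≤ k 0 := Nat.cast_nonneg _
      have b' : (0 : ℝ) ≤ k' 0 := Nat.cast_nonneg _
      push_cast
      rcases lt_or_gt_of_ne hrow with h | h
      · have h : (p : ℝ) + 1 ≤ p' := by exact_mod_cast h
        rw [abs_sub_comm]
        refine le_trans ?_ (le_abs_self _)
        nlinarith
      · have h : (p' : ℝ) + 1 ≤ p := by exact_mod_cast h
        refine le_trans ?_ (le_abs_self _)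
        nlinarith

theorem data (N m : ℕ) (F : (Fin (m + 1) → ℝ) → ℝ) (ε α : ℝ) (hε : 0 < ε) (hα : 0 < α)
    (hα1 : α ≤ 1) (hF : ∀ y y', |F y - F y'| ≤ ε * ‖y - y'‖ ^ α) :
    ∃ y : ℕ → ℝ, (∀ k, |y (k + 1) - y k| ≤ ε) ∧
      ∀ k : Fin (m + 1) → ℕ, (∀ j, k j < N) → y (idx N m k) = F (fun j => (k j : ℝ)) := by
  set s : Set ℕ := {n | ∃ k : Fin (m + 1) → ℕ, (∀ j, k j < N) ∧ idx N m k = n} with hs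
  have hc : ∀ n, ∃ k : Fin (m + 1) → ℕ, n ∈ s → ((∀ j, k j < N) ∧ idx N m k = n) := by
    intro n
    by_cases h : n ∈ s
    · obtain ⟨k, hk⟩ := h
      exact ⟨k, fun _ => hk⟩
    · exact ⟨0, fun h' => absurd h' h⟩
  choose c hc using hc
  have hL : LipschitzOnWith ε.toNNReal (fun n => F (fun j => (c n j : ℝ))) s := by
    refine LipschitzOnWith.of_dist_le_mul ?_
    intro a ha b hb
    have h := idx_holder N m F ε α hε hα hα1 hF (c a) (c b) (hc a ha).1 (hc b hb).1
    rw [(hc a ha).2, (hc b hb).2] at h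
    rw [Real.coe_toNNReal _ hε.le, Real.dist_eq, Nat.dist_eq]
    exact h
  obtain ⟨g, hg1, hg2⟩ := hL.extend_real
  refine ⟨g, ?_, ?_⟩
  · intro k
    have := hg1.dist_le_mul (k + 1) k
    rw [Real.coe_toNNReal _ hε.le, Real.dist_eq, Nat.dist_eq] at this
    simpa using this
  · intro k hk
    have hm : idx N m k ∈ s := ⟨k, hk, rfl⟩
    rw [← hg2 hm]
    have h := idx_holder N m F ε α hε hα hα1 hF _ k (hc _ hm).1 hk
    rw [(hc _ hm).2, sub_self, abs_zero, mul_zero] at h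
    have := abs_nonpos_iff.1 h
    simp only
    linarith

end data

section core

/-- Coordinate functions. -/
def Co (d : ℕ) : Set ((Fin d → ℝ) → ℝ) := Set.range (fun j y => y j)

/-- Points away from the trifling region. -/
def Good (t : ℝ) : Prop := ∀ n : ℕ, 1 ≤ n → (n : ℝ) ≤ t ∨ t ≤ n - 1 / 4

theorem base (m n N W L w : ℕ) (hN0 : N ≠ 0) (hL : 0 < L) (hW : 0 < W)
    (hN : N ≤ (L * (2 * n)) * (L * (2 * n))) (hNd : N ^ (m + 1) ≤ (W * L) ^ 2)
    (hw1 : (m + 1) * (4 * n + 3) ≤ w) (hw2 : 3 * W + 6 ≤ w)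
    (F : (Fin (m + 1) → ℝ) → ℝ) (ε α : ℝ) (hε : 0 < ε) (hα : 0 < α)
    (hα1 : α ≤ 1) (hF : ∀ y y', |F y - F y'| ≤ ε * ‖y - y'‖ ^ α) :
    ∃ φ, Steps w (8 * L + 1) (Co (m + 1)) {φ} ∧ ∀ y : Fin (m + 1) → ℝ,
      (∀ j, -1 ≤ y j ∧ y j < N ∧ Good (y j)) →
      |φ y - F (fun j => ((⌊y j⌋₊ : ℕ) : ℝ))| ≤ 2 * ε := by
  obtain ⟨y, hy1, hy2⟩ := data N m F ε α hε hα hα1 hF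
  obtain ⟨z, C, hz, hzy⟩ := quant y ε hε hy1
  set D : Set (Fin (m + 1) → ℝ) := {y | ∀ j, -1 ≤ y j ∧ y j < N ∧ Good (y j)} with hD
  set ρ : D → (Fin (m + 1) → ℝ) := Subtype.val with hρ
  set k : D → Fin (m + 1) → ℕ := fun x j => ⌊ρ x j⌋₊ with hk
  have hkN : ∀ x j, k x j < N := fun x j => (Nat.floor_lt' hN0).2 (x.2 j).2.1
  have s1 : Steps w (2 * L) (pull ρ (Co (m + 1))) (⋃ j, {fun x => (k x j : ℝ)}) := by
    have c1 : ∀ j : Fin (m + 1), Steps (4 * n + 3) (2 * L) (pull ρ (Co (m + 1)))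
        {fun x => (k x j : ℝ)} := by
      intro j
      have := coord (fun x : D => ρ x j) (fun x => (x.2 j).1) (fun x => (x.2 j).2.2) (2 * n) L N hN0
        (fun x => (x.2 j).2.1) hN
      refine (this.pre ?_).width (by omega)
      intro f hf
      rw [Set.mem_singleton_iff.1 hf]
      exact Aff.self ⟨fun y => y j, ⟨j, rfl⟩, rfl⟩
    have c2 := Steps.iUnion _ c1
    rw [Fintype.card_fin] at c2
    exact c2.width hw1
  set i : D → ℕ := fun x => idx N m (k x) with hi
  have him : (fun x => (i x : ℝ)) ∈ Aff (⋃ j, {fun x => (k x j : ℝ)} : Set (D → ℝ)) := by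
    have mk : ∀ j, (fun x => (k x j : ℝ)) ∈ Aff (⋃ j, {fun x => (k x j : ℝ)} : Set (D → ℝ)) :=
      fun j => Aff.self (Set.mem_iUnion.2 ⟨j, rfl⟩)
    refine Aff.congr (Aff.add (mk 0) (Aff.mul (2 * N : ℝ) (Aff.sum Finset.univ
      (fun (j : Fin m) x => ((N : ℝ) ^ (j : ℕ)) * (k x j.succ : ℝ))
      fun j _ => Aff.mul _ (mk j.succ)))) ?_
    intro x
    simp only [hi, idx]
    push_cast
    congr 2
    exact Finset.sum_congr rfl fun j _ => mul_comm _ _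
  have s2 := fit i W L (2 * L) hW (by omega) (by
    intro x
    have := idx_lt N m (k x) (hkN x)
    have h2 : L * W * (W * (2 * L)) = 2 * (W * L) ^ 2 := by ring
    rw [h2]
    exact lt_of_lt_of_le this (Nat.mul_le_mul_left _ hNd)) z hz
  have s3 := s2.union (Steps.carry (l := L + (1 + (L + 2 * (2 * L))))
    (Aff.self (Set.mem_singleton (fun x => (i x : ℝ)))) 0 (fun x => Nat.cast_nonneg _))
  have s4 := s1.trans ((s3.pre (R := (⋃ j, {fun x => (k x j : ℝ)} : Set (D → ℝ))) (by
    intro f hf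
    rw [Set.mem_singleton_iff.1 hf]
    exact him)).width (by omega))
  rw [show 2 * L + (L + (1 + (L + 2 * (2 * L)))) = 8 * L + 1 by ring] at s4
  have s5 := s4.post (R := {fun x => 2 * ε * (z (i x) : ℝ) - ε * (i x : ℝ) + C}) (by
    intro f hf
    rw [Set.mem_singleton_iff.1 hf]
    exact Aff.add (Aff.sub (Aff.mul _ (Aff.self (Or.inl rfl))) (Aff.mul _ (Aff.self (Or.inr rfl))))
      (Aff.const C))
  obtain ⟨φ, h1, h2⟩ := Steps.lift ρ s5
  refine ⟨φ, h1, ?_⟩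
  intro x hx
  have e := congrFun h2 ⟨x, hx⟩
  have e2 := hzy (i ⟨x, hx⟩)
  have e3 : y (i ⟨x, hx⟩) = F (fun j => ((⌊x j⌋₊ : ℕ) : ℝ)) := hy2 (k ⟨x, hx⟩) (hkN _)
  simp only [Function.comp] at e
  have e4 : φ x = φ (ρ ⟨x, hx⟩) := rfl
  rw [e4, e, ← e3, abs_sub_comm]
  exact e2

theorem good_bad {t : ℝ} (h : ¬ Good t) : ∃ n : ℕ, (n : ℝ) - 1 / 4 < t ∧ t < n := by
  unfold Good at h
  push Not at h
  obtain ⟨n, _, h1, h2⟩ := h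
  exact ⟨n, h2, h1⟩

theorem bad_pair {t t' : ℝ} (h1 : t + 1 / 4 ≤ t') (h2 : t' ≤ t + 1 / 2) : Good t ∨ Good t' := by
  by_contra h
  push Not at h
  obtain ⟨n, a, b⟩ := good_bad h.1
  obtain ⟨n', a', b'⟩ := good_bad h.2
  have : (n : ℝ) < n' := by linarith
  have : (n : ℝ) + 1 ≤ n' := by exact_mod_cast this
  linarith

/-- The middle value of three numbers. -/
noncomputable def mid (a b c : ℝ) : ℝ := a + b - c - max (max a b - c) 0 + max (c - min a b) 0

theorem mid_close (a b c v E : ℝ)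
    (h : (|a - v| ≤ E ∧ |b - v| ≤ E) ∨ (|a - v| ≤ E ∧ |c - v| ≤ E) ∨ (|b - v| ≤ E ∧ |c - v| ≤ E)) :
    |mid a b c - v| ≤ E := by
  unfold mid
  simp only [abs_le] at *
  rcases max_cases a b with ⟨h1, _⟩ | ⟨h1, _⟩ <;> rcases min_cases a b with ⟨h2, _⟩ | ⟨h2, _⟩ <;>
  rw [h1, h2] <;>
  rcases max_cases (a - c) 0 with ⟨h3, _⟩ | ⟨h3, _⟩ <;>
  rcases max_cases (b - c) 0 with ⟨h4, _⟩ | ⟨h4, _⟩ <;>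
  rcases max_cases (c - a) 0 with ⟨h5, _⟩ | ⟨h5, _⟩ <;>
  rcases max_cases (c - b) 0 with ⟨h6, _⟩ | ⟨h6, _⟩ <;>
  simp only [h3, h4, h5, h6] <;>
  rcases h with ⟨⟨_, _⟩, _, _⟩ | ⟨⟨_, _⟩, _, _⟩ | ⟨⟨_, _⟩, _, _⟩ <;>
  constructor <;> linarith


theorem Steps.mid {X : Type*} (S : Set (X → ℝ)) (a b c : X → ℝ) (ha : a ∈ Aff S) (hb : b ∈ Aff S)
    (hc : c ∈ Aff S) : Steps 7 2 S {fun x => RN.mid (a x) (b x) (c x)} := by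
  have A := (((Step.relu (Aff.sub ha hb)).union (Step.signed ha)).union (Step.signed hb)).union
    (Step.signed hc)
  set V : Set (X → ℝ) := {RN.relu (fun x => a x - b x)} ∪ {a} ∪ {b} ∪ {c} with hV
  have v0 : RN.relu (fun x => a x - b x) ∈ Aff V := Aff.self (Or.inl (Or.inl (Or.inl rfl)))
  have va : a ∈ Aff V := Aff.self (Or.inl (Or.inl (Or.inr rfl)))
  have vb : b ∈ Aff V := Aff.self (Or.inl (Or.inr rfl))
  have vc : c ∈ Aff V := Aff.self (Or.inr rfl)
  have hmax : ∀ x, max (a x) (b x) = b x + RN.relu (fun x => a x - b x) x := by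
    intro x
    simp only [RN.relu]
    rcases le_total (a x) (b x) with h | h
    · rw [max_eq_right h, max_eq_right (by linarith)]; ring
    · rw [max_eq_left h, max_eq_left (by linarith)]; ring
  have hmin : ∀ x, min (a x) (b x) = a x - RN.relu (fun x => a x - b x) x := by
    intro x
    have := hmax x
    have := min_add_max (a x) (b x)
    linarith
  have vM : (fun x => max (a x) (b x)) ∈ Aff V := Aff.congr (Aff.add vb v0) hmax
  have vm : (fun x => min (a x) (b x)) ∈ Aff V := Aff.congr (Aff.sub va v0) hmin
  have B := ((Step.relu (Aff.sub vM vc)).union (Step.relu (Aff.sub vc vm))).union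
    (Step.signed (Aff.sub (Aff.add va vb) vc))
  have B' : Step 7 V {fun x => RN.mid (a x) (b x) (c x)} := by
    refine (B.post ?_).width (by norm_num)
    intro f hf
    rw [Set.mem_singleton_iff.1 hf]
    refine Aff.congr (Aff.add (Aff.sub (Aff.self (Or.inr rfl)) (Aff.self (Or.inl (Or.inl rfl))))
      (Aff.self (Or.inl (Or.inr rfl)))) ?_
    intro x
    simp only [RN.mid, RN.relu]
  exact (Step.steps (A.width (by norm_num : _ ≤ 7))).trans B'.steps

theorem shift_steps (d w l : ℕ) (j : Fin d) (t : ℝ) (φ : (Fin d → ℝ) → ℝ)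
    (h : Steps w l (Co d) {φ}) :
    Steps w l (Co d) {fun y => φ (Function.update y j (y j + t))} := by
  have := (h.pull (fun y : Fin d → ℝ => Function.update y j (y j + t))).pre (R := Co d) (by
    rintro _ ⟨_, ⟨i, rfl⟩, rfl⟩
    by_cases hij : i = j
    · subst hij
      refine Aff.congr (Aff.add (Aff.self ⟨i, rfl⟩) (Aff.const t)) ?_
      intro y; simp
    · refine Aff.congr (Aff.self ⟨i, rfl⟩) ?_
      intro y; simp [hij])
  refine this.post ?_
  intro f hf
  rw [Set.mem_singleton_iff.1 hf]
  exact Aff.self ⟨φ, rfl, rfl⟩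

theorem mid_trick (d w l : ℕ) (hw : 3 ≤ w) (φ₀ : (Fin d → ℝ) → ℝ) (h₀ : Steps w l (Co d) {φ₀})
    (i : ℕ) (hi : i ≤ d) :
    ∃ φ, Steps (3 ^ i * w) (l + 2 * i) (Co d) {φ} ∧
      ∀ (x₀ : Fin d → ℝ) (v E : ℝ),
        (∀ y : Fin d → ℝ, (∀ j, |y j - x₀ j| ≤ 1 / 4) → (∀ j, Good (y j)) → |φ₀ y - v| ≤ E) →
        ∀ y : Fin d → ℝ, (∀ j : Fin d, (j : ℕ) < i → y j = x₀ j) →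
          (∀ j : Fin d, ¬ (j : ℕ) < i → Good (y j)) →
          (∀ j, |y j - x₀ j| ≤ 1 / 4) → |φ y - v| ≤ E := by
  induction i with
  | zero =>
    refine ⟨φ₀, by simpa using h₀, ?_⟩
    intro x₀ v E h y _ h2 h3
    exact h y h3 (fun j => h2 j (by simp))
  | succ i ih =>
    obtain ⟨φ, hφ, hp⟩ := ih (by omega)
    set J : Fin d := ⟨i, by omega⟩ with hJ
    have hm := shift_steps d _ _ J (-(1 / 4)) φ hφ
    have hpl := shift_steps d _ _ J (1 / 4) φ hφ
    have U := (hm.union hφ).union hpl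
    have Mi := Steps.mid ({fun y => φ (Function.update y J (y J + -(1 / 4)))} ∪ {φ} ∪
      {fun y => φ (Function.update y J (y J + 1 / 4))}) _ _ _
      (Aff.self (Or.inl (Or.inl rfl))) (Aff.self (Or.inl (Or.inr rfl))) (Aff.self (Or.inr rfl))
    have hpos : 1 ≤ 3 ^ i := Nat.one_le_pow _ _ (by norm_num)
    have hge : 7 ≤ 3 ^ (i + 1) * w := by
      rw [pow_succ]
      nlinarith
    have T := (U.width (w₂ := 3 ^ (i + 1) * w) (by rw [pow_succ]; apply le_of_eq; ring)).trans
      (Mi.width hge)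
    refine ⟨_, T, ?_⟩
    intro x₀ v E h y h1 h2 h3
    have key : ∀ t : ℝ, |t| ≤ 1 / 4 → Good (y J + t) →
        |φ (Function.update y J (y J + t)) - v| ≤ E := by
      intro t ht hg
      refine hp x₀ v E h _ ?_ ?_ ?_
      · intro j hj
        have : j ≠ J := by
          intro hh; rw [hh, hJ] at hj; simp at hj
        rw [Function.update_of_ne this]
        exact h1 j (by omega)
      · intro j hj
        by_cases hjJ : j = J
        · rw [hjJ, Function.update_self]; exact hg
        · rw [Function.update_of_ne hjJ]
          refine h2 j ?_
          intro hlt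
          apply hjJ
          rw [hJ]
          ext
          simp only
          omega
      · intro j
        by_cases hjJ : j = J
        · rw [hjJ, Function.update_self, h1 J (by simp [hJ])]
          simpa using ht
        · rw [Function.update_of_ne hjJ]
          exact h3 j
    have k1 := key (-(1 / 4)) (by norm_num [abs_of_pos])
    have k2 := key 0 (by norm_num)
    have k3 := key (1 / 4) (by norm_num [abs_of_pos])
    rw [add_zero, Function.update_eq_self] at k2
    have p1 : Good (y J + -(1 / 4)) ∨ Good (y J) := bad_pair (by linarith) (by linarith)
    have p2 : Good (y J + -(1 / 4)) ∨ Good (y J + 1 / 4) := bad_pair (by linarith) (by linarith)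
    have p3 : Good (y J) ∨ Good (y J + 1 / 4) := bad_pair (by linarith) (by linarith)
    refine mid_close _ _ _ _ _ ?_
    tauto

theorem core_thm (m n N W L w : ℕ) (hN0 : N ≠ 0) (hL : 0 < L) (hW : 0 < W)
    (hN : N ≤ (L * (2 * n)) * (L * (2 * n))) (hNd : N ^ (m + 1) ≤ (W * L) ^ 2)
    (hw1 : (m + 1) * (4 * n + 3) ≤ w) (hw2 : 3 * W + 6 ≤ w)
    (F : (Fin (m + 1) → ℝ) → ℝ) (ε α : ℝ) (hε : 0 < ε) (hα : 0 < α)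
    (hα1 : α ≤ 1) (hF : ∀ y y', |F y - F y'| ≤ ε * ‖y - y'‖ ^ α) :
    ∃ φ, Steps (3 ^ (m + 1) * w) (8 * L + 1 + 2 * (m + 1)) (Co (m + 1)) {φ} ∧
      ∀ y : Fin (m + 1) → ℝ, (∀ j, 0 ≤ y j ∧ y j ≤ N - 1 / 2) → |F y - φ y| ≤ 13 / 4 * ε := by
  obtain ⟨φ₀, h1, h2⟩ := base m n N W L w hN0 hL hW hN hNd hw1 hw2 F ε α hε hα hα1 hF
  obtain ⟨φ, h3, h4⟩ := mid_trick (m + 1) w (8 * L + 1) (by omega) φ₀ h1 (m + 1) le_rfl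
  refine ⟨φ, h3, ?_⟩
  intro x₀ hx
  rw [abs_sub_comm]
  refine h4 x₀ (F x₀) _ ?_ x₀ (fun _ _ => rfl) (fun j hj => absurd j.2 hj) (fun j => by simp)
  intro y hy hg
  have b1 := h2 y (fun j => by
    have := abs_le.1 (hy j)
    have := hx j
    exact ⟨by linarith, by linarith, hg j⟩)
  have b2 := hF (fun j => ((⌊y j⌋₊ : ℕ) : ℝ)) x₀
  have b3 : ‖(fun j => ((⌊y j⌋₊ : ℕ) : ℝ)) - x₀‖ ≤ 5 / 4 := by
    refine (pi_norm_le_iff_of_nonneg (by norm_num)).2 ?_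
    intro j
    have h5 := abs_le.1 (hy j)
    have h6 := hx j
    simp only [Pi.sub_apply, Real.norm_eq_abs]
    have h7 := Nat.lt_floor_add_one (y j)
    rcases le_total 0 (y j) with h | h
    · have h8 := Nat.floor_le h
      rw [abs_le]; constructor <;> linarith
    · rw [Nat.floor_of_nonpos h]
      push_cast
      rw [abs_le]; constructor <;> linarith
  have b4 : ‖(fun j => ((⌊y j⌋₊ : ℕ) : ℝ)) - x₀‖ ^ α ≤ 5 / 4 := by
    calc _ ≤ (5 / 4 : ℝ) ^ α := Real.rpow_le_rpow (norm_nonneg _) b3 hα.le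
      _ ≤ (5 / 4 : ℝ) ^ (1 : ℝ) := Real.rpow_le_rpow_of_exponent_le (by norm_num) hα1
      _ = 5 / 4 := Real.rpow_one _
  have b5 : |F (fun j => ((⌊y j⌋₊ : ℕ) : ℝ)) - F x₀| ≤ ε * (5 / 4) :=
    b2.trans (mul_le_mul_of_nonneg_left b4 hε.le)
  have := abs_sub_le (φ₀ y) (F (fun j => ((⌊y j⌋₊ : ℕ) : ℝ))) (F x₀)
  linarith

end core

section conversion

/-- Layer dimensions: input `d`, then `w`. -/
def dimf (d w : ℕ) : ℕ → ℕ
  | 0 => d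
  | _ + 1 => w

theorem forward_congr (dims : ℕ → ℕ)
    (A A' : ∀ n : ℕ, Matrix (Fin (dims (n + 1))) (Fin (dims n)) ℝ)
    (b b' : ∀ n : ℕ, Fin (dims (n + 1)) → ℝ) (n : ℕ) (hA : ∀ k < n, A k = A' k)
    (hb : ∀ k < n, b k = b' k) (x : Fin (dims 0) → ℝ) :
    reluForward dims A b n x = reluForward dims A' b' n x := by
  induction n with
  | zero => rfl
  | succ n ih =>
    funext i
    simp only [reluForward]
    rw [ih (fun k hk => hA k (by omega)) (fun k hk => hb k (by omega)), hA n (by omega),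
      hb n (by omega)]

theorem forward_step (dims : ℕ → ℕ)
    (A : ∀ n : ℕ, Matrix (Fin (dims (n + 1))) (Fin (dims n)) ℝ)
    (b : ∀ n : ℕ, Fin (dims (n + 1)) → ℝ) (n : ℕ)
    (An : Matrix (Fin (dims (n + 1))) (Fin (dims n)) ℝ) (bn : Fin (dims (n + 1)) → ℝ)
    (x : Fin (dims 0) → ℝ) (i : Fin (dims (n + 1))) :
    reluForward dims (Function.update A n An) (Function.update b n bn) (n + 1) x i =
      max ((∑ j, An i j * reluForward dims A b n x j) + bn i) 0 := by
  simp only [reluForward]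
  rw [forward_congr dims (Function.update A n An) A (Function.update b n bn) b n
    (fun k hk => Function.update_of_ne (by omega) _ _)
    (fun k hk => Function.update_of_ne (by omega) _ _), Function.update_self,
    Function.update_self]
  rfl

theorem mem_aff_range {X : Type*} {q : ℕ} (h : Fin q → X → ℝ) {f : X → ℝ}
    (hf : f ∈ Aff (Set.range h)) : ∃ (c : Fin q → ℝ) (c₀ : ℝ), ∀ x, f x = ∑ i, c i * h i x + c₀ := by
  obtain ⟨a, g, hg, rfl⟩ := Submodule.mem_span_insert.1 hf
  obtain ⟨c, rfl⟩ := (Submodule.mem_span_range_iff_exists_fun ℝ).1 hg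
  refine ⟨c, a, ?_⟩
  intro x
  simp [add_comm]

theorem finset_family {X : Type*} (G : Finset (X → ℝ)) (w : ℕ) (h : G.card ≤ w) :
    ∃ g : Fin w → X → ℝ, (∀ i, g i ∈ G ∨ g i = 0) ∧ ∀ f ∈ G, ∃ i, g i = f := by
  refine ⟨fun i => if hi : (i : ℕ) < G.card then G.equivFin.symm ⟨i, hi⟩ else 0, ?_, ?_⟩
  · intro i
    by_cases hi : (i : ℕ) < G.card
    · left; simp only [hi, dif_pos]; exact (G.equivFin.symm ⟨i, hi⟩).2
    · right; simp only [hi, dif_neg, not_false_eq_true]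
  · intro f hf
    have hlt := (G.equivFin ⟨f, hf⟩).2
    refine ⟨⟨G.equivFin ⟨f, hf⟩, lt_of_lt_of_le hlt h⟩, ?_⟩
    simp only [hlt, dif_pos]
    simp

theorem convert_aux (d w : ℕ) (l : ℕ) : ∀ (n : ℕ) (S : Set ((Fin d → ℝ) → ℝ)) (φ : (Fin d → ℝ) → ℝ)
    (A : ∀ n : ℕ, Matrix (Fin (dimf d w (n + 1))) (Fin (dimf d w n)) ℝ)
    (b : ∀ n : ℕ, Fin (dimf d w (n + 1)) → ℝ),
    S ⊆ Aff (Set.range (fun i (x : Fin d → ℝ) => reluForward (dimf d w) A b n x i)) → Steps w l S {φ} →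
    ∃ (A' : ∀ n : ℕ, Matrix (Fin (dimf d w (n + 1))) (Fin (dimf d w n)) ℝ)
      (b' : ∀ n : ℕ, Fin (dimf d w (n + 1)) → ℝ),
      φ ∈ Aff (Set.range (fun i (x : Fin d → ℝ) => reluForward (dimf d w) A' b' (n + l) x i)) := by
  induction l with
  | zero =>
    intro n S φ A b hS h
    exact ⟨A, b, Aff.le hS (h rfl)⟩
  | succ l ih =>
    intro n S φ A b hS h
    obtain ⟨R, ⟨G, g1, g2, g3⟩, h2⟩ := h
    obtain ⟨g, hg1, hg2⟩ := finset_family G w g1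
    have hgm : ∀ i, g i ∈ Aff (Set.range (fun i (x : Fin d → ℝ) => reluForward (dimf d w) A b n x i)) := by
      intro i
      rcases hg1 i with h | h
      · exact Aff.le hS (g2 _ h)
      · rw [h]; exact Submodule.zero_mem _
    choose c c₀ hc using fun i => mem_aff_range _ (hgm i)
    let An : Matrix (Fin (dimf d w (n + 1))) (Fin (dimf d w n)) ℝ := Matrix.of fun i j => c i j
    let bn : Fin (dimf d w (n + 1)) → ℝ := c₀
    have hfw : ∀ (i : Fin w) (x : Fin d → ℝ), reluForward (dimf d w)
        (Function.update A n An) (Function.update b n bn) (n + 1) x i = relu (g i) x := by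
      intro i x
      refine (forward_step (dimf d w) A b n An bn x i).trans ?_
      simp only [relu]
      rw [hc i x]
      rfl
    obtain ⟨A', b', h3⟩ := ih (n + 1) R φ (Function.update A n An) (Function.update b n bn) (by
      refine g3.trans (Aff.mono ?_)
      rintro _ ⟨f, hf, rfl⟩
      obtain ⟨i, hi⟩ := hg2 f hf
      refine ⟨i, ?_⟩
      funext x
      rw [← hi]
      exact hfw i x) h2
    refine ⟨A', b', ?_⟩
    rw [show n + (l + 1) = n + 1 + l by ring]
    exact h3

theorem toNet (d w l : ℕ) (φ : (Fin d → ℝ) → ℝ) (h : Steps w l (Co d) {φ}) :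
    IsReLUNet d w l (fun x => φ (fun j => x j)) := by
  obtain ⟨A, b, h1⟩ := convert_aux d w l 0 (Co d) φ (fun _ => 0) (fun _ => 0) (by
    rintro _ ⟨j, rfl⟩
    exact Aff.self ⟨j, rfl⟩) h
  rw [zero_add] at h1
  obtain ⟨c, c₀, hc⟩ := mem_aff_range _ h1
  refine ⟨dimf d w, rfl, ?_, A, b, c, c₀, ?_⟩
  · intro n hn _
    cases n with
    | zero => omega
    | succ n => exact le_rfl
  · intro x
    exact hc _

end conversion

section final

theorem holder_ext {X : Type*} [NormedAddCommGroup X] (E : Set X) (hne : E.Nonempty) (f : X → ℝ)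
    (lam α : ℝ) (hα : 0 < α) (hα1 : α ≤ 1) (hlam : 0 < lam)
    (hf : ∀ x ∈ E, ∀ y ∈ E, |f x - f y| ≤ lam * ‖x - y‖ ^ α) :
    ∃ g : X → ℝ, (∀ x ∈ E, g x = f x) ∧ ∀ x y, |g x - g y| ≤ lam * ‖x - y‖ ^ α := by
  have tri : ∀ x y z : X, lam * ‖x - y‖ ^ α ≤ lam * ‖x - z‖ ^ α + lam * ‖z - y‖ ^ α := by
    intro x y z
    have h1 : ‖x - y‖ ≤ ‖x - z‖ + ‖z - y‖ := norm_sub_le_norm_sub_add_norm_sub _ _ _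
    have h2 := (Real.rpow_le_rpow (norm_nonneg _) h1 hα.le).trans
      (Real.rpow_add_le_add_rpow (norm_nonneg _) (norm_nonneg _) hα.le hα1)
    rw [← mul_add]
    exact mul_le_mul_of_nonneg_left h2 hlam.le
  have : Nonempty E := hne.to_subtype
  obtain ⟨y₀, hy₀⟩ := hne
  have bdd : ∀ x : X, BddBelow (Set.range fun y : E => f y + lam * ‖x - y‖ ^ α) := by
    intro x
    refine ⟨f y₀ - lam * ‖y₀ - x‖ ^ α, ?_⟩
    rintro _ ⟨y, rfl⟩
    have h1 := (abs_le.1 (hf y₀ hy₀ y y.2)).2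
    have h2 := tri y₀ y x
    simp only
    linarith
  have key : ∀ x y : X, (⨅ z : E, f z + lam * ‖x - z‖ ^ α) ≤
      (⨅ z : E, f z + lam * ‖y - z‖ ^ α) + lam * ‖x - y‖ ^ α := by
    intro x y
    rw [← sub_le_iff_le_add]
    refine le_ciInf ?_
    intro z
    have h1 := ciInf_le (bdd x) z
    have h2 := tri x z y
    linarith
  refine ⟨fun x => ⨅ z : E, f z + lam * ‖x - z‖ ^ α, ?_, ?_⟩
  · intro x hx
    apply le_antisymm
    · have h1 := ciInf_le (bdd x) ⟨x, hx⟩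
      simpa [Real.zero_rpow hα.ne'] using h1
    · refine le_ciInf ?_
      intro z
      have := (abs_le.1 (hf x hx z z.2)).2
      linarith
  · intro x y
    have h1 := key x y
    have h2 := key y x
    rw [norm_sub_rev y x] at h2
    rw [abs_le]
    constructor <;> simp only <;> linarith

theorem numerics (d W L : ℕ) (hd : 0 < d) (hW : 0 < W) (hL : 0 < L) :
    ∃ (n N : ℕ) (Z : ℝ), n = Nat.floor ((W : ℝ) ^ ((1 : ℝ) / d)) ∧ 1 ≤ n ∧ 1 ≤ N ∧ 1 ≤ Z ∧
      Z / 4 ≤ (N : ℝ) - 1 / 2 ∧ N ≤ (L * (2 * n)) * (L * (2 * n)) ∧ N ^ d ≤ (W * L) ^ 2 ∧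
      ∀ α : ℝ, Z ^ (-α) = (W : ℝ) ^ (-(2 * α / d)) * (L : ℝ) ^ (-(2 * α / d)) := by
  have hd' : (0 : ℝ) < d := by exact_mod_cast hd
  have hd1 : (1 : ℝ) ≤ d := by exact_mod_cast hd
  have hW' : (1 : ℝ) ≤ W := by exact_mod_cast hW
  have hL' : (1 : ℝ) ≤ L := by exact_mod_cast hL
  have hWL : (1 : ℝ) ≤ (W : ℝ) * L := by nlinarith
  set u : ℝ := (W : ℝ) ^ ((1 : ℝ) / d) with hu
  set v : ℝ := (L : ℝ) ^ ((1 : ℝ) / d) with hv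
  have hu1 : 1 ≤ u := Real.one_le_rpow hW' (by positivity)
  have hv1 : 1 ≤ v := Real.one_le_rpow hL' (by positivity)
  have hvL : v ≤ L := by
    calc v ≤ (L : ℝ) ^ (1 : ℝ) := Real.rpow_le_rpow_of_exponent_le hL' (by
          rw [div_le_one hd']; exact hd1)
      _ = L := Real.rpow_one _
  have hZ1 : 1 ≤ (u * v) ^ 2 := one_le_pow₀ (by nlinarith)
  have hn1 : 1 ≤ ⌊u⌋₊ := Nat.le_floor (by simpa using hu1)
  have hN1 : 1 ≤ ⌊(u * v) ^ 2⌋₊ := Nat.le_floor (by simpa using hZ1)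
  have hNle : ((⌊(u * v) ^ 2⌋₊ : ℕ) : ℝ) ≤ (u * v) ^ 2 := Nat.floor_le (by positivity)
  refine ⟨⌊u⌋₊, ⌊(u * v) ^ 2⌋₊, (u * v) ^ 2, rfl, hn1, hN1, hZ1, ?_, ?_, ?_, ?_⟩
  · have h1 := Nat.lt_floor_add_one ((u * v) ^ 2)
    have h2 : (1 : ℝ) ≤ (⌊(u * v) ^ 2⌋₊ : ℕ) := by exact_mod_cast hN1
    linarith
  · have h1 := Nat.lt_floor_add_one u
    have h2 : (1 : ℝ) ≤ (⌊u⌋₊ : ℕ) := by exact_mod_cast hn1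
    have h3 : u * v ≤ (L : ℝ) * (2 * (⌊u⌋₊ : ℕ)) := by
      rw [mul_comm u v]
      exact mul_le_mul hvL (by linarith) (by linarith) (by linarith)
    have h4 : (u * v) ^ 2 ≤ ((L : ℝ) * (2 * (⌊u⌋₊ : ℕ))) ^ 2 :=
      pow_le_pow_left₀ (by positivity) h3 2
    have h5 := hNle.trans h4
    rw [sq (_ * (2 * _))] at h5
    exact_mod_cast h5
  · have h1 : ((⌊(u * v) ^ 2⌋₊ : ℕ) : ℝ) ^ d ≤ ((u * v) ^ 2) ^ d :=
      pow_le_pow_left₀ (by positivity) hNle d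
    have h2 : ((u * v) ^ 2) ^ d = ((W : ℝ) * L) ^ 2 := by
      have hud : u ^ d = W := by
        rw [hu, one_div]; exact Real.rpow_inv_natCast_pow (by positivity) hd.ne'
      have hvd : v ^ d = L := by
        rw [hv, one_div]; exact Real.rpow_inv_natCast_pow (by positivity) hd.ne'
      rw [← pow_mul, mul_comm 2 d, pow_mul, mul_pow, hud, hvd]
    rw [h2] at h1
    exact_mod_cast h1
  · intro α
    have hW0 : (0 : ℝ) ≤ W := by linarith
    have hL0 : (0 : ℝ) ≤ L := by linarith
    rw [mul_pow, Real.mul_rpow (by positivity) (by positivity), hu, hv,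
      ← Real.rpow_natCast, ← Real.rpow_natCast, ← Real.rpow_mul hW0, ← Real.rpow_mul hL0,
      ← Real.rpow_mul hW0, ← Real.rpow_mul hL0]
    congr 2 <;> · push_cast; ring

theorem norm_le_sup (d : ℕ) (x : EuclideanSpace ℝ (Fin d)) (M : ℝ) (hM : 0 ≤ M)
    (h : ∀ j, |x j| ≤ M) : ‖x‖ ≤ Real.sqrt d * M := by
  rw [EuclideanSpace.norm_eq]
  calc Real.sqrt (∑ i, ‖x i‖ ^ 2) ≤ Real.sqrt (d * M ^ 2) := by
        apply Real.sqrt_le_sqrt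
        calc ∑ i, ‖x i‖ ^ 2 ≤ ∑ _i : Fin d, M ^ 2 :=
              Finset.sum_le_sum fun i _ => pow_le_pow_left₀ (norm_nonneg _) (h i) 2
          _ = d * M ^ 2 := by simp
    _ = Real.sqrt d * M := by
        rw [Real.sqrt_mul (by positivity), Real.sqrt_sq hM]

theorem main_pos (m : ℕ) (B : ℝ) (hB : 0 < B) (α lam : ℝ)
    (hα : 0 < α) (hα1 : α ≤ 1) (hlam : 0 < lam)
    (g : EuclideanSpace ℝ (Fin (m + 1)) → ℝ)
    (hg : ∀ x y, |g x - g y| ≤ lam * ‖x - y‖ ^ α)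
    (W L : ℕ) (hW : 0 < W) (hL : 0 < L) :
    ∃ φ : EuclideanSpace ℝ (Fin (m + 1)) → ℝ,
      IsReLUNet (m + 1) (3 ^ (m + 1 + 3) *
        max ((m + 1) * Nat.floor ((W : ℝ) ^ ((1 : ℝ) / ((m + 1 : ℕ) : ℝ)))) (W + 1))
        (8 * L + 1 + 2 * (m + 1)) φ ∧
      ∀ x, (∀ i, x i ∈ Set.Icc (-B) B) → |g x - φ x| ≤
        19 * Real.sqrt ((m + 1 : ℕ) : ℝ) * lam * (2 * B) ^ α *
          (W : ℝ) ^ (-(2 * α / ((m + 1 : ℕ) : ℝ))) *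
          (L : ℝ) ^ (-(2 * α / ((m + 1 : ℕ) : ℝ))) := by
  obtain ⟨n, N, Z, hn, hn1, hN1, hZ1, hNZ, hN, hNd, hpow⟩ :=
    numerics (m + 1) W L (by omega) hW hL
  rw [← hn]
  have hN1' : (1 : ℝ) ≤ N := by exact_mod_cast hN1
  set q : ℝ := (N : ℝ) - 1 / 2 with hq
  have hq0 : 0 < q := by rw [hq]; linarith
  set s : ℝ := 2 * B / q with hs
  have hs0 : 0 < s := by positivity
  set r : ℝ := Real.sqrt ((m + 1 : ℕ) : ℝ) with hr
  have hr1 : 1 ≤ r := by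
    rw [hr, Real.one_le_sqrt]; exact_mod_cast Nat.succ_le_succ (Nat.zero_le m)
  have hε : 0 < lam * (r * s) ^ α := by positivity
  obtain ⟨φ, h1, h2⟩ := core_thm m n N W L (27 * max ((m + 1) * n) (W + 1)) (by omega) hL hW hN hNd
    (by
      have := le_max_left ((m + 1) * n) (W + 1)
      nlinarith [Nat.mul_le_mul_left (m + 1) hn1])
    (by
      have := le_max_right ((m + 1) * n) (W + 1)
      omega)
    (fun y => g (WithLp.toLp 2 fun j => s * y j - B)) (lam * (r * s) ^ α) α hε hα hα1 (by
      intro y y'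
      refine (hg _ _).trans ?_
      rw [mul_assoc, ← Real.mul_rpow (by positivity) (norm_nonneg _)]
      refine mul_le_mul_of_nonneg_left (Real.rpow_le_rpow (norm_nonneg _) ?_ hα.le) hlam.le
      rw [mul_assoc]
      refine norm_le_sup _ _ _ (by positivity) ?_
      intro j
      have h3 := norm_le_pi_norm (y - y') j
      rw [Real.norm_eq_abs, Pi.sub_apply] at h3
      have h4 : (WithLp.toLp 2 (fun j => s * y j - B) - WithLp.toLp 2 (fun j => s * y' j - B) :
          EuclideanSpace ℝ (Fin (m + 1))) j = s * (y j - y' j) := by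
        simp; ring
      rw [h4, abs_mul, abs_of_pos hs0]
      exact mul_le_mul_of_nonneg_left h3 hs0.le)
  have h3 := (h1.pull (fun x : Fin (m + 1) → ℝ => fun j => q / (2 * B) * (x j + B))).pre
    (R := Co (m + 1)) (by
      rintro _ ⟨_, ⟨i, rfl⟩, rfl⟩
      exact Aff.mul _ (Aff.add (Aff.self ⟨i, rfl⟩) (Aff.const B)))
  have h4 : Steps (3 ^ (m + 1 + 3) * max ((m + 1) * n) (W + 1)) (8 * L + 1 + 2 * (m + 1))
      (Co (m + 1)) {fun x => φ (fun j => q / (2 * B) * (x j + B))} := by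
    refine (h3.post ?_).width (le_of_eq ?_)
    · intro f hf
      rw [Set.mem_singleton_iff.1 hf]
      exact Aff.self ⟨φ, rfl, rfl⟩
    · rw [pow_add _ (m + 1) 3]; ring
  refine ⟨_, toNet _ _ _ _ h4, ?_⟩
  intro x hx
  have h5 := h2 (fun j => q / (2 * B) * (x j + B)) (by
    intro j
    obtain ⟨ha, hb⟩ := hx j
    constructor
    · have : 0 ≤ x j + B := by linarith
      positivity
    · rw [← hq, div_mul_eq_mul_div, div_le_iff₀ (by positivity)]
      exact mul_le_mul_of_nonneg_left (by linarith) hq0.le)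
  have h6 : (WithLp.toLp 2 fun j => s * (q / (2 * B) * (x j + B)) - B :
      EuclideanSpace ℝ (Fin (m + 1))) = x := by
    ext j
    have : s * (q / (2 * B)) = 1 := by rw [hs]; field_simp
    simp only [← mul_assoc, this]
    ring
  simp only [h6] at h5
  refine h5.trans ?_
  have hsle : r * s ≤ (4 * r) * ((2 * B) * Z⁻¹) := by
    have : s ≤ 4 * ((2 * B) * Z⁻¹) := by
      rw [hs, div_le_iff₀ hq0]
      have hZ0 : 0 < Z := by linarith
      calc 2 * B = 4 * (2 * B * Z⁻¹) * (Z / 4) := by field_simp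
        _ ≤ _ := mul_le_mul_of_nonneg_left hNZ (by positivity)
    nlinarith
  have h7 : (r * s) ^ α ≤ (4 * r) * ((2 * B) ^ α * Z ^ (-α)) := by
    have hZ0 : 0 < Z := by linarith
    calc (r * s) ^ α ≤ ((4 * r) * ((2 * B) * Z⁻¹)) ^ α :=
          Real.rpow_le_rpow (by positivity) hsle hα.le
      _ = (4 * r) ^ α * ((2 * B) ^ α * Z ^ (-α)) := by
          rw [Real.mul_rpow (by positivity) (by positivity),
            Real.mul_rpow (x := 2 * B) (by positivity) (by positivity), Real.inv_rpow hZ0.le,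
            Real.rpow_neg hZ0.le]
      _ ≤ _ := by
          refine mul_le_mul_of_nonneg_right ?_ (by positivity)
          calc (4 * r) ^ α ≤ (4 * r) ^ (1 : ℝ) :=
                Real.rpow_le_rpow_of_exponent_le (by linarith) hα1
            _ = 4 * r := Real.rpow_one _
  rw [hpow α] at h7
  set P : ℝ := (2 * B) ^ α * ((W : ℝ) ^ (-(2 * α / ((m + 1 : ℕ) : ℝ))) *
          (L : ℝ) ^ (-(2 * α / ((m + 1 : ℕ) : ℝ)))) with hP
  have hP0 : 0 ≤ P := by positivity
  have h8 : lam * (r * s) ^ α ≤ lam * (4 * r * P) := mul_le_mul_of_nonneg_left h7 hlam.le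
  have h9 : 0 ≤ lam * r * P := by positivity
  calc 13 / 4 * (lam * (r * s) ^ α) ≤ 19 * r * lam * P := by nlinarith
    _ = _ := by rw [hP]; ring

theorem const_net (d w : ℕ) (c : ℝ) : IsReLUNet d w 0 (fun _ => c) :=
  toNet d w 0 (fun _ => c) (by
    intro f hf
    rw [Set.mem_singleton_iff.1 hf]
    exact Aff.const c)

end final

end RN

/-- (ReLU approximation of Hölder functions) If
`f : E → ℝ` (with `E ⊆ [−B,B]^d`) is `α`-Hölder with constant `λ`, then for any
`W, L ∈ ℕ⁺` there is a ReLU network `φ` of width at most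
`3^{d+3} max{d⌊W^{1/d}⌋, W+1}` and depth at most `12L+14+2d` with
`sup_{x∈E} |f(x) − φ(x)| ≤ 19√d · λ(2B)^α W^{−2α/d} L^{−2α/d}`. -/
theorem stmt_14 (d : ℕ) (B : ℝ) (hB : 0 < B) (α lam : ℝ)
    (hα : 0 < α) (hα1 : α ≤ 1) (hlam : 0 < lam)
    (E : Set (EuclideanSpace ℝ (Fin d)))
    (hE : ∀ x ∈ E, ∀ i : Fin d, x i ∈ Set.Icc (-B) B)
    (f : EuclideanSpace ℝ (Fin d) → ℝ)
    (hf : ∀ x ∈ E, ∀ y ∈ E, |f x - f y| ≤ lam * ‖x - y‖ ^ α)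
    (W L : ℕ) (hW : 0 < W) (hL : 0 < L) :
    ∃ l ≤ 12 * L + 14 + 2 * d, ∃ φ : EuclideanSpace ℝ (Fin d) → ℝ,
      IsReLUNet d (3 ^ (d + 3) * max (d * Nat.floor ((W : ℝ) ^ ((1 : ℝ) / d))) (W + 1)) l φ ∧
      ∀ x ∈ E, |f x - φ x| ≤
        19 * Real.sqrt d * lam * (2 * B) ^ α *
          (W : ℝ) ^ (-(2 * α / d)) * (L : ℝ) ^ (-(2 * α / d)) := by
  rcases Set.eq_empty_or_nonempty E with rfl | hne
  · exact ⟨0, by omega, fun _ => 0, RN.const_net _ _ _, by simp⟩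
  cases d with
  | zero =>
    refine ⟨0, by omega, fun _ => f 0, RN.const_net _ _ _, ?_⟩
    intro x _
    rw [Subsingleton.elim x 0]
    simp
  | succ m =>
    obtain ⟨g, hg1, hg2⟩ := RN.holder_ext E hne f lam α hα hα1 hlam hf
    obtain ⟨φ, h1, h2⟩ := RN.main_pos m B hB α lam hα hα1 hlam g hg2 W L hW hL
    refine ⟨8 * L + 1 + 2 * (m + 1), by omega, φ, h1, ?_⟩
    intro x hx
    rw [← hg1 x hx]
    exact h2 x (hE x hx)
end
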